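/- Let (X,π) be a totally connected (d+1)-partite weighted pure d-dimensional complex with parts indexed by [d]. Suppose {f_S}_{S ⊂ [d], |S| < d} is a family of nonnegative vectors f_S ∈ R^{[d]} such that for every S ⊂ [d] with |S| = (d+1)−k (so k ≥ 2): the support of f_S is contained in [d]∖S, and (1) if G_S is disconnected with connected components on vertex sets I_1,…,I_ℓ, then f_S = ∑_{1≤i≤ℓ : |I_i| ≥ 2} f_{[d]∖I_i}; (2) if G_S is connected, then max_{i∈[d]} f_S(i) ≤ (k−1)²/(3k−1), and moreover (i) if k = 2, then for every face τ of type S and every i ∈ [d]∖S, λ2(P_τ) ≤ f_S(i), and (ii) if k ≥ 3, then for every i ∈ [d]∖S, ∑_{j∈[d]∖(S∪{i})} f_{S∪{j}}(i) ≤ (k−2)·f_S(i) − f_S(i)². Then for every k ≥ 2 and every face τ of co-dimension k and type S, λ2(P_τ) ≤ (max_{i∈[d]} f_S(i))/(k−1). -/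

import Mathlib

open Finset in
/-- A pure `d`-dimensional weighted simplicial complex, given by its facets (all of
cardinality `d+1`) together with a full-support probability distribution `pi` on the facets.
The faces of the complex are all subsets of facets. -/
structure WeightedComplex (V : Type*) [Fintype V] [DecidableEq V] (d : ℕ) where
  facets : Finset (Finset V)
  facets_nonempty : facets.Nonempty
  pure : ∀ τ ∈ facets, τ.card = d + 1
  pi : Finset V → ℝ
  pi_pos : ∀ τ ∈ facets, 0 < pi τ
  pi_eq_zero : ∀ τ, τ ∉ facets → pi τ = 0
  pi_sum_one : ∑ τ ∈ facets, pi τ = 1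

namespace WeightedComplex

variable {V : Type*} [Fintype V] [DecidableEq V] {d : ℕ}

/-- `σ` is a face of the complex (a subset of some facet). -/
def IsFace (K : WeightedComplex V d) (σ : Finset V) : Prop :=
  ∃ η ∈ K.facets, σ ⊆ η

/-- Total `π`-weight of the facets containing `τ`. -/
noncomputable def faceWeight (K : WeightedComplex V d) (τ : Finset V) : ℝ :=
  ∑ η ∈ K.facets.filter (fun η => τ ⊆ η), K.pi η

/-- `Pr_{σ ∼ π_τ}[{x,y} ⊆ σ]`: the weight of the edge `{x,y}` in the 1-skeleton of the
link of `τ`. -/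
noncomputable def linkWeight (K : WeightedComplex V d) (τ : Finset V) (x y : V) : ℝ :=
  if x = y ∨ x ∈ τ ∨ y ∈ τ then 0
  else (∑ η ∈ K.facets.filter (fun η => τ ⊆ η ∧ x ∈ η ∧ y ∈ η), K.pi η) / K.faceWeight τ

/-- The transition probability matrix `P_τ` of the simple random walk on the 1-skeleton of
the link `(X_τ, π_τ)`, padded with zeros outside the `X_τ(0) × X_τ(0)` block. -/
noncomputable def walkMatrix (K : WeightedComplex V d) (τ : Finset V) : Matrix V V ℝ :=
  Matrix.of fun x y => K.linkWeight τ x y / ∑ z, K.linkWeight τ x z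

/-- `Pr_{σ ∼ π_τ}[x ∈ σ]`. -/
noncomputable def probMem (K : WeightedComplex V d) (τ : Finset V) (x : V) : ℝ :=
  if x ∈ τ then 0 else K.faceWeight (insert x τ) / K.faceWeight τ

/-- The vertex marginal `π_{τ,0}(x) = Pr_{σ∼π_τ}[x ∈ σ] / codim(τ)`, viewed as a vector on all
of `V` (zero outside `X_τ(0)`). -/
noncomputable def vertexMarginal (K : WeightedComplex V d) (τ : Finset V) (x : V) : ℝ :=
  ((d + 1 - τ.card : ℕ) : ℝ)⁻¹ * K.probMem τ x

/-- The facets of the link `X_τ`. -/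
def linkFacets (K : WeightedComplex V d) (τ : Finset V) : Finset (Finset V) :=
  (K.facets.filter (fun η => τ ⊆ η)).image (fun η => η \ τ)

/-- The facet distribution `π_τ` of the link of `τ`. -/
noncomputable def linkPi (K : WeightedComplex V d) (τ : Finset V) (σ : Finset V) : ℝ :=
  K.pi (σ ∪ τ) / K.faceWeight τ

/-- The 1-skeleton of the link of every face of co-dimension at least 2 is connected. -/
def TotallyConnected (K : WeightedComplex V d) : Prop :=
  ∀ τ : Finset V, K.IsFace τ → τ.card + 2 ≤ d + 1 →
    ∀ x y : V, x ∉ τ → K.IsFace (insert x τ) → y ∉ τ → K.IsFace (insert y τ) →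
      Relation.ReflTransGen (fun a b => 0 < K.linkWeight τ a b) x y

end WeightedComplex

/-- The second largest eigenvalue of a random-walk transition matrix `P`: the largest point of
the real spectrum of `P` lying below the trivial top eigenvalue `1`. -/
noncomputable def lambda2 {n : Type*} [Fintype n] [DecidableEq n] (P : Matrix n n ℝ) : ℝ :=
  sSup {μ : ℝ | μ < 1 ∧ μ ∈ spectrum ℝ P}

/-- A `(d+1)`-partite pure `d`-dimensional weighted complex: each vertex has a type in
`Fin (d+1)` and every facet contains exactly one vertex of each type. -/
structure PartiteWeightedComplex (V : Type*) [Fintype V] [DecidableEq V] (d : ℕ)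
    extends WeightedComplex V d where
  vtype : V → Fin (d + 1)
  partite : ∀ τ ∈ facets, ∀ i : Fin (d + 1), (τ.filter (fun x => vtype x = i)).card = 1

namespace PartiteWeightedComplex

variable {V : Type*} [Fintype V] [DecidableEq V] {d : ℕ}

/-- `ε_{i,j}`: the maximum of `λ₂(P_τ)` over faces `τ` of type `[d] ∖ {i,j}`. -/
noncomputable def eps (K : PartiteWeightedComplex V d) (i j : Fin (d + 1)) : ℝ :=
  sSup {r : ℝ | ∃ τ : Finset V, K.toWeightedComplex.IsFace τ ∧
    τ.image K.vtype = Finset.univ \ {i, j} ∧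
    r = lambda2 (K.toWeightedComplex.walkMatrix τ)}

/-- `Δ(i)`: the number of `j ≠ i` with `ε_{i,j} > 0`. -/
noncomputable def DeltaAt (K : PartiteWeightedComplex V d) (i : Fin (d + 1)) : ℕ :=
  Set.ncard {j : Fin (d + 1) | j ≠ i ∧ 0 < K.eps i j}

/-- `Δ = max_i Δ(i)`. -/
noncomputable def DeltaMax (K : PartiteWeightedComplex V d) : ℕ :=
  Finset.univ.sup fun i => K.DeltaAt i

end PartiteWeightedComplex

namespace PartiteWeightedComplex

variable {V : Type*} [Fintype V] [DecidableEq V] {d : ℕ}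

/-- Adjacency in the graph `G_{(X,π)}` on the set of types `[d]`: `i ~ j` iff `ε_{i,j} > 0`. -/
def gAdj (K : PartiteWeightedComplex V d) (i j : Fin (d + 1)) : Prop :=
  i ≠ j ∧ 0 < K.eps i j

/-- The induced subgraph `G_S` of `G_{(X,π)}` on `[d] ∖ S` is connected. -/
def GConnOn (K : PartiteWeightedComplex V d) (S : Finset (Fin (d + 1))) : Prop :=
  ∀ i ∉ S, ∀ j ∉ S,
    Relation.ReflTransGen (fun a b => a ∉ S ∧ b ∉ S ∧ K.gAdj a b) i j

/-- The connected component of `i` in the induced subgraph `G_S`. -/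
noncomputable def gComp (K : PartiteWeightedComplex V d) (S : Finset (Fin (d + 1)))
    (i : Fin (d + 1)) : Finset (Fin (d + 1)) :=
  (Set.toFinite {j : Fin (d + 1) |
    Relation.ReflTransGen (fun a b => a ∉ S ∧ b ∉ S ∧ K.gAdj a b) i j}).toFinset

end PartiteWeightedComplex

open Finset in
/-- A symmetric kernel `b` dominated by the weight `w` that is not positive semidefinite has a
`w`-weighted eigenvector with negative eigenvalue. -/
theorem exists_weighted_eigenvector_of_neg {V : Type*} [Fintype V] [DecidableEq V]
    {w : V → ℝ} (hw : ∀ x, 0 ≤ w x) {b : V → V → ℝ} (hb : ∀ x y, b x y = b y x)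
    (hb0 : ∀ x y, w x = 0 → b x y = 0) {g : V → ℝ}
    (hg : ∑ x, g x * ∑ y, b x y * g y < 0) :
    ∃ l < 0, ∃ h : V → ℝ, (∃ x, h x ≠ 0) ∧ (∀ x, w x = 0 → h x = 0) ∧
      ∀ x, ∑ y, b x y * h y = l * (w x * h x) := by
  set M : Matrix V V ℝ := Matrix.of fun x y => b x y / (√(w x) * √(w y)) with hM
  have hs : ∀ x, w x ≠ 0 → √(w x) ≠ 0 := fun x hx =>
    (Real.sqrt_pos.2 (lt_of_le_of_ne (hw x) (Ne.symm hx))).ne'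
  have hH : M.IsHermitian := by
    ext x y
    simp [hM, hb x y, mul_comm]
  have hb0' : ∀ x y, w y = 0 → b x y = 0 := fun x y hy => by rw [hb, hb0 y x hy]
  have hrow : ∀ x (v : V → ℝ), √(w x) * (M.mulVec v) x = ∑ y, b x y * (v y / √(w y)) := by
    intro x v
    simp only [Matrix.mulVec, dotProduct, mul_sum]
    refine sum_congr rfl fun y _ => ?_
    by_cases hx : w x = 0
    · simp [hx, hb0 x y hx]
    · by_cases hy : w y = 0
      · simp [hM, hy]
      · have := hs x hx
        have := hs y hy
        simp only [hM, Matrix.of_apply]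
        field_simp
  by_contra hcon
  push Not at hcon
  have hpos : M.PosSemidef := by
    rw [hH.posSemidef_iff_eigenvalues_nonneg]
    intro i
    by_contra hi
    simp only [Pi.zero_apply, not_le] at hi
    set v : V → ℝ := (hH.eigenvectorBasis i).ofLp with hv
    have hev : M.mulVec v = hH.eigenvalues i • v := hH.mulVec_eigenvectorBasis i
    have hv0 : ∀ x, w x = 0 → v x = 0 := by
      intro x hx
      have h1 := congrFun hev x
      have h2 : (M.mulVec v) x = 0 := by
        simp [Matrix.mulVec, dotProduct, hM, hx]
      rw [h2] at h1
      simpa [hi.ne] using h1.symm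
    have hvne : ∃ x, v x ≠ 0 := by
      by_contra hall
      push Not at hall
      have h1 : ‖hH.eigenvectorBasis i‖ = 1 := hH.eigenvectorBasis.orthonormal.1 i
      have h2 : hH.eigenvectorBasis i = 0 := by
        ext x
        exact hall x
      rw [h2] at h1
      simp at h1
    obtain ⟨x₀, hx₀⟩ := hvne
    have hwx₀ : w x₀ ≠ 0 := fun h => hx₀ (hv0 x₀ h)
    obtain ⟨x, hx⟩ := hcon _ hi (fun x => v x / √(w x)) ⟨x₀, div_ne_zero hx₀ (hs x₀ hwx₀)⟩
      (fun x hx => by simp [hx])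
    apply hx
    rw [← hrow, hev]
    by_cases hx : w x = 0
    · simp [hx]
    · have h1 := hs x hx
      have h2 := Real.mul_self_sqrt (hw x)
      simp only [Pi.smul_apply, smul_eq_mul]
      field_simp
      rw [sq, h2]
      ring
  have hp := hpos.dotProduct_mulVec_nonneg (fun x => √(w x) * g x)
  refine absurd hp (not_le.2 (lt_of_eq_of_lt ?_ hg))
  simp only [dotProduct]
  refine sum_congr rfl fun x _ => ?_
  simp only [Pi.star_apply, star_trivial]
  rw [mul_comm (√(w x)), mul_assoc, hrow]
  congr 1
  refine sum_congr rfl fun y _ => ?_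
  by_cases hy : w y = 0
  · simp [hb0' x y hy]
  · have := hs y hy
    field_simp

open Finset in
/-- If the centred walk form exceeds the diagonal form of `F`, there is a witnessing weighted
eigenvector. -/
theorem exists_eigenvector_of_lt_walkForm {V : Type*} [Fintype V] [DecidableEq V]
    {w : V → ℝ} (hw : ∀ x, 0 ≤ w x) {c : V → V → ℝ} (hc : ∀ x y, c x y = c y x)
    (hc0 : ∀ x y, w x = 0 → c x y = 0) {F : V → ℝ} {r W : ℝ} (hW : 0 < W)
    (hrow : ∀ x, ∑ y, c x y = r * w x) (htot : ∑ x, w x = (r + 1) * W) {g : V → ℝ}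
    (hg : ∑ x, w x * F x * g x ^ 2 <
      ∑ x, g x * ∑ y, c x y * g y - (∑ x, w x * g x) ^ 2 / W) :
    ∃ u > 0, ∃ (m : ℝ) (h : V → ℝ), (∃ x, h x ≠ 0) ∧ (∀ x, w x = 0 → h x = 0) ∧
      (∑ x, w x * h x = m * W) ∧ (∑ x, w x * (F x + u) * h x = - (m * W)) ∧
      ∀ x, ∑ y, c x y * h y = (F x + u) * (w x * h x) + w x * m := by
  have hrowb : ∀ (g : V → ℝ) x, ∑ y, ((if x = y then w x * F x else 0) - c x y + w x * w y / W)
      * g y = w x * F x * g x - ∑ y, c x y * g y + w x * (∑ y, w y * g y) / W := by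
    intro g x
    simp only [add_mul, sub_mul, sum_add_distrib, sum_sub_distrib, ite_mul, zero_mul,
      sum_ite_eq, mem_univ, if_true]
    congr 1
    rw [mul_sum, sum_div]
    exact sum_congr rfl fun y _ => by ring
  obtain ⟨l, hl, h, hne, hsupp, heq⟩ := exists_weighted_eigenvector_of_neg hw
    (b := fun x y => (if x = y then w x * F x else 0) - c x y + w x * w y / W) (g := g)
    (fun x y => by
      by_cases hxy : x = y
      · simp [hxy]
      · simp [hxy, Ne.symm hxy, hc x y, mul_comm])
    (fun x y hx => by simp [hx, hc0 x y hx])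
    (by
      simp only [hrowb]
      have : ∑ x, g x * (w x * F x * g x - ∑ y, c x y * g y + w x * (∑ y, w y * g y) / W)
          = ∑ x, w x * F x * g x ^ 2 - ∑ x, g x * ∑ y, c x y * g y
            + (∑ x, w x * g x) ^ 2 / W := by
        simp only [mul_add, mul_sub, sum_add_distrib, sum_sub_distrib]
        congr 1
        · congr 1
          exact sum_congr rfl fun y _ => by ring
        · rw [sq, sum_mul, sum_div]
          exact sum_congr rfl fun y _ => by ring
      rw [this]
      linarith)
  simp only [hrowb] at heq
  have heq' : ∀ x, ∑ y, c x y * h y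
      = (F x + -l) * (w x * h x) + w x * ((∑ y, w y * h y) / W) := by
    intro x
    have := heq x
    rw [mul_div_assoc] at this
    linear_combination -this
  refine ⟨-l, by linarith, (∑ y, w y * h y) / W, h, hne, hsupp, ?_, ?_, heq'⟩
  · field_simp
  · have h1 : ∑ x, ∑ y, c x y * h y = r * ∑ x, w x * h x := by
      rw [sum_comm, mul_sum]
      refine sum_congr rfl fun y _ => ?_
      rw [← sum_mul, sum_congr rfl fun x _ => hc x y, hrow]
      ring
    have h2 := sum_congr rfl fun x (_ : x ∈ (univ : Finset V)) => heq' x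
    rw [h1, sum_add_distrib, ← sum_mul, htot] at h2
    have h3 : ∑ x, w x * (F x + -l) * h x = ∑ x, (F x + -l) * (w x * h x) :=
      sum_congr rfl fun x _ => by ring
    rw [h3]
    field_simp at h2 ⊢
    linarith

open Finset in
/-- The walk form is controlled by the eigenvalues in `(0, r)` of a connected weighted graph. -/
theorem walkForm_le_of_eigenvalue_le {V : Type*} [Fintype V] [DecidableEq V]
    {w : V → ℝ} (hw : ∀ x, 0 ≤ w x) {c : V → V → ℝ} (hc : ∀ x y, c x y = c y x)
    (hc0 : ∀ x y, w x = 0 → c x y = 0)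
    (hcn : ∀ x y, 0 ≤ c x y) {r W θ : ℝ} (hW : 0 < W) (hθ : 0 ≤ θ)
    (hrow : ∀ x, ∑ y, c x y = r * w x) (htot : ∑ x, w x = (r + 1) * W)
    (hconn : ∀ x y, w x ≠ 0 → w y ≠ 0 → Relation.ReflTransGen (fun a b => 0 < c a b) x y)
    (heig : ∀ (μ : ℝ) (h : V → ℝ), 0 < μ → μ < r → (∃ x, h x ≠ 0) →
      (∀ x, w x = 0 → h x = 0) → ∑ x, w x * h x = 0 →
      (∀ x, ∑ y, c x y * h y = μ * (w x * h x)) → μ ≤ θ) (g : V → ℝ) :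
    ∑ x, g x * ∑ y, c x y * g y - (∑ x, w x * g x) ^ 2 / W ≤ θ * ∑ x, w x * g x ^ 2 := by
  by_contra hcon
  rw [not_le, mul_sum] at hcon
  obtain ⟨u, hu, m, h, ⟨x₀, hx₀⟩, hsupp, hsum, hsum', heq⟩ :=
    exists_eigenvector_of_lt_walkForm (F := fun _ => θ) hw hc hc0 hW hrow htot (g := g)
      (lt_of_eq_of_lt (sum_congr rfl fun x _ => by ring) hcon)
  have hm : m = 0 := by
    have h1 : (θ + u) * ∑ x, w x * h x = -(m * W) := by
      rw [← hsum', mul_sum]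
      exact sum_congr rfl fun x _ => by ring
    rw [hsum] at h1
    have h2 : m * (W * (θ + u + 1)) = 0 := by linear_combination h1
    exact (mul_eq_zero.1 h2).resolve_right (by positivity)
  subst hm
  simp only [mul_zero, add_zero, zero_mul] at heq hsum
  have hwx₀ : w x₀ ≠ 0 := fun hx => hx₀ (hsupp _ hx)
  rcases lt_or_ge (θ + u) r with hlt | hge
  · linarith [heig (θ + u) h (by linarith) hlt ⟨x₀, hx₀⟩ hsupp hsum heq]
  have hdir : ∑ x, ∑ y, c x y * (h x - h y) ^ 2
      = 2 * ((r - (θ + u)) * ∑ x, w x * h x ^ 2) := by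
    have h1 : ∑ x, ∑ y, c x y * h x ^ 2 = r * ∑ x, w x * h x ^ 2 := by
      rw [mul_sum]
      refine sum_congr rfl fun x _ => ?_
      rw [← sum_mul, hrow]
      ring
    have h2 : ∑ x, ∑ y, c x y * h y ^ 2 = r * ∑ x, w x * h x ^ 2 := by
      rw [sum_comm, ← h1]
      exact sum_congr rfl fun y _ => sum_congr rfl fun x _ => by rw [hc]
    have h3 : ∑ x, ∑ y, c x y * (h x * h y) = (θ + u) * ∑ x, w x * h x ^ 2 := by
      rw [mul_sum]
      refine sum_congr rfl fun x _ => ?_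
      have : ∑ y, c x y * (h x * h y) = h x * ∑ y, c x y * h y := by
        rw [mul_sum]
        exact sum_congr rfl fun y _ => by ring
      rw [this, heq]
      ring
    have h4 : ∑ x, ∑ y, c x y * (h x - h y) ^ 2 = ∑ x, ∑ y, c x y * h x ^ 2
        + ∑ x, ∑ y, c x y * h y ^ 2 - 2 * ∑ x, ∑ y, c x y * (h x * h y) := by
      simp only [mul_sum, ← sum_add_distrib, ← sum_sub_distrib]
      exact sum_congr rfl fun x _ => sum_congr rfl fun y _ => by ring
    rw [h4, h1, h2, h3]
    ring
  have hn : 0 ≤ ∑ x, w x * h x ^ 2 :=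
    sum_nonneg fun x _ => mul_nonneg (hw x) (sq_nonneg _)
  have hterm : ∀ x y, 0 ≤ c x y * (h x - h y) ^ 2 :=
    fun x y => mul_nonneg (hcn x y) (sq_nonneg _)
  have hzero : ∑ x, ∑ y, c x y * (h x - h y) ^ 2 = 0 := by
    refine le_antisymm ?_ (sum_nonneg fun x _ => sum_nonneg fun y _ => hterm x y)
    rw [hdir]
    nlinarith
  have hedge : ∀ x y, 0 < c x y → h x = h y := by
    intro x y hxy
    have h1 := (sum_eq_zero_iff_of_nonneg
      (fun x _ => sum_nonneg fun y _ => hterm x y)).1 hzero x (mem_univ _)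
    have h2 := (sum_eq_zero_iff_of_nonneg (fun y _ => hterm x y)).1 h1 y (mem_univ _)
    have h3 := (mul_eq_zero.1 h2).resolve_left hxy.ne'
    exact sub_eq_zero.1 (pow_eq_zero_iff two_ne_zero |>.1 h3)
  have hconst : ∀ x, w x ≠ 0 → h x = h x₀ := by
    intro x hx
    induction hconn x₀ x hwx₀ hx with
    | refl => rfl
    | tail _ hbc ih =>
      rw [← hedge _ _ hbc]
      apply ih
      intro hb
      rw [hc0 _ _ hb] at hbc
      exact lt_irrefl _ hbc
  have h1 : ∑ x, w x * h x = (r + 1) * W * h x₀ := by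
    rw [← htot, sum_mul]
    refine sum_congr rfl fun x _ => ?_
    by_cases hx : w x = 0
    · simp [hx]
    · rw [hconst x hx]
  have hpos : 0 < (r + 1) * W := by
    rw [← htot]
    exact sum_pos' (fun x _ => hw x) ⟨x₀, mem_univ _, lt_of_le_of_ne (hw x₀) (Ne.symm hwx₀)⟩
  rw [hsum] at h1
  exact mul_ne_zero hpos.ne' hx₀ h1.symm

open Finset in
/-- Quadratic comparison: an upper bound on `(r - 1) R - R²` for the centred walk form `R`
upgrades the a priori bound `R ≤ (r - 1) / 2` to a bound on `R`. -/
theorem walkForm_le_of_quadratic_le {V : Type*} [Fintype V] [DecidableEq V]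
    {w : V → ℝ} (hw : ∀ x, 0 ≤ w x) {c : V → V → ℝ} (hc : ∀ x y, c x y = c y x)
    (hc0 : ∀ x y, w x = 0 → c x y = 0) {F : V → ℝ} {r W : ℝ} (hW : 0 < W)
    (hrow : ∀ x, ∑ y, c x y = r * w x) (htot : ∑ x, w x = (r + 1) * W)
    (hrec : ∀ g : V → ℝ, (r - 1) * ∑ x, g x * ∑ y, c x y * g y -
      ∑ x, (∑ y, c x y * g y) ^ 2 / w x ≤ ∑ x, w x * ((r - 1) * F x - F x ^ 2) * g x ^ 2)
    (hbd : ∀ g : V → ℝ, ∑ x, g x * ∑ y, c x y * g y - (∑ x, w x * g x) ^ 2 / W ≤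
      (r - 1) / 2 * ∑ x, w x * g x ^ 2) (g : V → ℝ) :
    ∑ x, g x * ∑ y, c x y * g y - (∑ x, w x * g x) ^ 2 / W ≤ ∑ x, w x * F x * g x ^ 2 := by
  by_contra hcon
  rw [not_le] at hcon
  obtain ⟨u, hu, m, h, ⟨x₀, hx₀⟩, hsupp, hsum, hsum', heq⟩ :=
    exists_eigenvector_of_lt_walkForm hw hc hc0 hW hrow htot hcon
  have hn : 0 < ∑ x, w x * h x ^ 2 := by
    have hwx₀ : 0 < w x₀ := lt_of_le_of_ne (hw x₀) fun hx => hx₀ (hsupp _ hx.symm)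
    exact sum_pos' (fun x _ => mul_nonneg (hw x) (sq_nonneg _))
      ⟨x₀, mem_univ _, mul_pos hwx₀ (by positivity)⟩
  have hB : ∑ x, h x * ∑ y, c x y * h y
      = ∑ x, w x * F x * h x ^ 2 + u * ∑ x, w x * h x ^ 2 + m ^ 2 * W := by
    have h1 : m ^ 2 * W = ∑ x, w x * h x * m := by
      rw [← sum_mul, hsum]
      ring
    rw [h1, mul_sum, ← sum_add_distrib, ← sum_add_distrib]
    refine sum_congr rfl fun x _ => ?_
    rw [heq]
    ring
  have hC : ∑ x, (∑ y, c x y * h y) ^ 2 / w x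
      = ∑ x, w x * F x ^ 2 * h x ^ 2 + 2 * u * ∑ x, w x * F x * h x ^ 2
        + u ^ 2 * ∑ x, w x * h x ^ 2 + (r - 1) * (m ^ 2 * W) := by
    have h1 : (r - 1) * (m ^ 2 * W)
        = 2 * m * ∑ x, w x * (F x + u) * h x + m ^ 2 * ∑ x, w x := by
      rw [hsum', htot]
      ring
    rw [h1]
    simp only [mul_sum, ← sum_add_distrib]
    refine sum_congr rfl fun x _ => ?_
    rw [heq]
    by_cases hx : w x = 0
    · simp [hx]
    · field_simp
      ring
  have hD : ∑ x, w x * ((r - 1) * F x - F x ^ 2) * h x ^ 2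
      = (r - 1) * ∑ x, w x * F x * h x ^ 2 - ∑ x, w x * F x ^ 2 * h x ^ 2 := by
    rw [mul_sum, ← sum_sub_distrib]
    exact sum_congr rfl fun x _ => by ring
  have h1 := hrec h
  have h2 := hbd h
  rw [hB, hC, hD] at h1
  rw [hB, hsum, mul_pow, sq W, ← mul_assoc, mul_div_cancel_right₀ _ hW.ne'] at h2
  have h3 : u * ((r - 1) * ∑ x, w x * h x ^ 2)
      ≤ u * (2 * ∑ x, w x * F x * h x ^ 2 + u * ∑ x, w x * h x ^ 2) := by linarith
  have h4 := le_of_mul_le_mul_left h3 hu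
  have h5 := mul_pos hu hn
  linarith

namespace WeightedComplex

open Finset

variable {V : Type*} [Fintype V] [DecidableEq V] {d : ℕ} (K : WeightedComplex V d)

/-- Unnormalized vertex weights of the link of `τ`. -/
noncomputable def linkVertexWeight (τ : Finset V) (x : V) : ℝ :=
  if x ∈ τ then 0 else K.faceWeight (insert x τ)

/-- Unnormalized edge weights of the 1-skeleton of the link of `τ`. -/
noncomputable def linkEdgeWeight (τ : Finset V) (x y : V) : ℝ :=
  if x ∈ τ then 0 else K.linkVertexWeight (insert x τ) y

/-- The quadratic form of the 1-skeleton of the link of `τ`, centred by the vertex weights. -/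
noncomputable def linkForm (τ : Finset V) (g : V → ℝ) : ℝ :=
  ∑ x, g x * ∑ y, K.linkEdgeWeight τ x y * g y
    - (∑ x, K.linkVertexWeight τ x * g x) ^ 2 / K.faceWeight τ

variable {K}

theorem faceWeight_nonneg (τ : Finset V) : 0 ≤ K.faceWeight τ :=
  sum_nonneg fun η hη => (K.pi_pos η (mem_filter.1 hη).1).le

theorem faceWeight_pos_iff {τ : Finset V} : 0 < K.faceWeight τ ↔ K.IsFace τ := by
  constructor
  · intro h
    obtain ⟨η, hη, -⟩ := exists_ne_zero_of_sum_ne_zero h.ne'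
    exact ⟨η, (mem_filter.1 hη).1, (mem_filter.1 hη).2⟩
  · rintro ⟨η, hη, hτ⟩
    exact sum_pos (fun η hη => K.pi_pos η (mem_filter.1 hη).1) ⟨η, mem_filter.2 ⟨hη, hτ⟩⟩

theorem faceWeight_ne_zero_iff {τ : Finset V} : K.faceWeight τ ≠ 0 ↔ K.IsFace τ := by
  rw [← faceWeight_pos_iff]
  exact (faceWeight_nonneg τ).lt_iff_ne'.symm

theorem IsFace.mono {σ τ : Finset V} (hτ : K.IsFace τ) (h : σ ⊆ τ) : K.IsFace σ :=
  let ⟨η, hη, hτη⟩ := hτ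
  ⟨η, hη, h.trans hτη⟩

theorem faceWeight_eq_zero_of_subset {σ τ : Finset V} (h : σ ⊆ τ) (hσ : K.faceWeight σ = 0) :
    K.faceWeight τ = 0 := by
  by_contra hτ
  exact faceWeight_ne_zero_iff.2 ((faceWeight_ne_zero_iff.1 hτ).mono h) hσ

theorem linkVertexWeight_nonneg (τ : Finset V) (x : V) : 0 ≤ K.linkVertexWeight τ x := by
  unfold linkVertexWeight
  split_ifs
  · exact le_rfl
  · exact faceWeight_nonneg _

theorem linkEdgeWeight_nonneg (τ : Finset V) (x y : V) : 0 ≤ K.linkEdgeWeight τ x y := by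
  unfold linkEdgeWeight
  split_ifs
  · exact le_rfl
  · exact linkVertexWeight_nonneg _ _

theorem linkVertexWeight_of_notMem {τ : Finset V} {x : V} (hx : x ∉ τ) :
    K.linkVertexWeight τ x = K.faceWeight (insert x τ) := if_neg hx

theorem linkEdgeWeight_of_notMem {τ : Finset V} {x : V} (hx : x ∉ τ) (y : V) :
    K.linkEdgeWeight τ x y = K.linkVertexWeight (insert x τ) y := if_neg hx

theorem linkVertexWeight_ne_zero_iff {τ : Finset V} {x : V} :
    K.linkVertexWeight τ x ≠ 0 ↔ x ∉ τ ∧ K.IsFace (insert x τ) := by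
  unfold linkVertexWeight
  split_ifs with h
  · simp [h]
  · simp [h, faceWeight_ne_zero_iff]

theorem linkEdgeWeight_eq (τ : Finset V) (x y : V) : K.linkEdgeWeight τ x y =
    if x = y ∨ x ∈ τ ∨ y ∈ τ then 0 else K.faceWeight (insert x (insert y τ)) := by
  unfold linkEdgeWeight linkVertexWeight
  rw [Finset.insert_comm x y τ]
  by_cases h1 : x ∈ τ <;> by_cases h2 : y ∈ τ <;> by_cases h3 : y = x <;>
    simp [h1, h2, h3, eq_comm (a := x)]

theorem linkEdgeWeight_ne_zero_iff {τ : Finset V} {x y : V} :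
    K.linkEdgeWeight τ x y ≠ 0 ↔
      x ≠ y ∧ x ∉ τ ∧ y ∉ τ ∧ K.IsFace (insert x (insert y τ)) := by
  rw [linkEdgeWeight_eq]
  split_ifs with h
  · simp; tauto
  · rw [faceWeight_ne_zero_iff]; tauto

theorem linkEdgeWeight_comm (τ : Finset V) (x y : V) :
    K.linkEdgeWeight τ x y = K.linkEdgeWeight τ y x := by
  rw [linkEdgeWeight_eq, linkEdgeWeight_eq, Finset.insert_comm x y τ]
  congr 1
  apply propext
  constructor <;> (intro h; tauto)

theorem linkEdgeWeight_eq_zero {τ : Finset V} {x : V} (y : V)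
    (hx : K.linkVertexWeight τ x = 0) : K.linkEdgeWeight τ x y = 0 := by
  by_contra h
  obtain ⟨-, h2, -, h4⟩ := linkEdgeWeight_ne_zero_iff.1 h
  exact linkVertexWeight_ne_zero_iff.2
    ⟨h2, h4.mono (insert_subset_insert _ (subset_insert _ _))⟩ hx

theorem linkVertexWeight_eq_zero {τ : Finset V} (x : V) (hτ : K.faceWeight τ = 0) :
    K.linkVertexWeight τ x = 0 := by
  unfold linkVertexWeight
  split_ifs
  · rfl
  · exact faceWeight_eq_zero_of_subset (subset_insert _ _) hτ

theorem linkWeight_eq (τ : Finset V) (x y : V) :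
    K.linkWeight τ x y = K.linkEdgeWeight τ x y / K.faceWeight τ := by
  rw [linkEdgeWeight_eq]
  unfold linkWeight
  split_ifs
  · simp
  · congr 1
    unfold faceWeight
    refine sum_congr (filter_congr fun η _ => ?_) fun _ _ => rfl
    simp only [insert_subset_iff]
    tauto

/-- Summing a function of the vertices over the link and exchanging with the facets. -/
theorem sum_linkVertexWeight_mul (τ : Finset V) (ψ : V → ℝ) :
    ∑ x, K.linkVertexWeight τ x * ψ x =
      ∑ η ∈ K.facets.filter (fun η => τ ⊆ η), K.pi η * ∑ x ∈ η \ τ, ψ x := by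
  have h1 : ∀ x, K.linkVertexWeight τ x * ψ x =
      ∑ η ∈ K.facets.filter (fun η => τ ⊆ η), if x ∈ η \ τ then K.pi η * ψ x else 0 := by
    intro x
    by_cases hx : x ∈ τ
    · simp [linkVertexWeight, hx]
    · rw [linkVertexWeight_of_notMem hx, faceWeight, sum_mul, ← sum_filter, filter_filter]
      refine sum_congr (filter_congr fun η _ => ?_) fun _ _ => rfl
      simp only [insert_subset_iff, mem_sdiff]
      tauto
  simp only [h1]
  rw [sum_comm]
  refine sum_congr rfl fun η _ => ?_
  rw [mul_sum, sum_ite_mem, univ_inter]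

theorem sum_linkVertexWeight (τ : Finset V) :
    ∑ x, K.linkVertexWeight τ x = ((d : ℝ) - τ.card + 1) * K.faceWeight τ := by
  have h := sum_linkVertexWeight_mul (K := K) τ (fun _ => 1)
  simp only [mul_one] at h
  rw [h, faceWeight, mul_sum]
  refine sum_congr rfl fun η hη => ?_
  obtain ⟨hη, hτ⟩ := mem_filter.1 hη
  rw [sum_const, nsmul_one, card_sdiff_of_subset hτ, Nat.cast_sub (card_le_card hτ), K.pure η hη]
  push_cast
  ring

theorem sum_linkEdgeWeight (τ : Finset V) (x : V) :
    ∑ y, K.linkEdgeWeight τ x y = ((d : ℝ) - τ.card) * K.linkVertexWeight τ x := by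
  by_cases hx : x ∈ τ
  · simp [linkEdgeWeight, linkVertexWeight, hx]
  · simp only [linkEdgeWeight_of_notMem hx, linkVertexWeight_of_notMem hx]
    rw [sum_linkVertexWeight, card_insert_of_notMem hx]
    push_cast
    ring

theorem sum_linkEdgeWeight_insert (τ : Finset V) (y z : V) :
    ∑ x ∈ univ \ τ, K.linkEdgeWeight (insert x τ) y z
      = ((d : ℝ) - τ.card - 1) * K.linkEdgeWeight τ y z := by
  by_cases h : y = z ∨ y ∈ τ ∨ z ∈ τ
  · rw [linkEdgeWeight_eq τ, if_pos h, mul_zero]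
    refine sum_eq_zero fun x _ => ?_
    rw [linkEdgeWeight_eq, if_pos]
    simp only [mem_insert]
    tauto
  · rw [linkEdgeWeight_eq τ, if_neg h]
    push Not at h
    obtain ⟨hyz, hy, hz⟩ := h
    have hcard : ((insert y (insert z τ)).card : ℝ) = τ.card + 2 := by
      rw [card_insert_of_notMem (by simp [hyz, hy]), card_insert_of_notMem hz]
      push_cast
      ring
    have h1 := sum_linkVertexWeight (K := K) (insert y (insert z τ))
    rw [hcard] at h1
    have h2 : (d : ℝ) - (τ.card + 2) + 1 = d - τ.card - 1 := by ring
    rw [← h2, ← h1]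
    rw [← sum_subset (subset_univ (univ \ τ))]
    · refine sum_congr rfl fun x hx => ?_
      rw [linkEdgeWeight_eq, linkVertexWeight, Finset.insert_comm z x, Finset.insert_comm y x]
      have hx' : x ∉ τ := by simpa using hx
      congr 1
      simp only [mem_insert, hyz, hy, hz, hx', or_false, false_or, eq_iff_iff]
      constructor <;> rintro (h | h) <;> simp [h]
    · intro x _ hx
      have hx' : x ∈ τ := by simpa using hx
      simp [linkVertexWeight, hx']

theorem linkEdgeWeight_connected (hconn : K.TotallyConnected) {τ : Finset V} (hτ : K.IsFace τ)
    (hcard : τ.card + 2 ≤ d + 1) (x y : V) (hx : K.linkVertexWeight τ x ≠ 0)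
    (hy : K.linkVertexWeight τ y ≠ 0) :
    Relation.ReflTransGen (fun a b => 0 < K.linkEdgeWeight τ a b) x y := by
  rw [linkVertexWeight_ne_zero_iff] at hx hy
  refine Relation.ReflTransGen.mono (fun a b hab => ?_) x y
    (hconn τ hτ hcard x y hx.1 hx.2 hy.1 hy.2)
  rw [linkWeight_eq] at hab
  have h := faceWeight_pos_iff.2 hτ
  exact (div_pos_iff_of_pos_right h).1 hab

theorem linkForm_le_of_eigenvalue_le (hconn : K.TotallyConnected) {τ : Finset V}
    (hτ : K.IsFace τ) (hcard : τ.card + 2 ≤ d + 1) {θ : ℝ} (hθ : 0 ≤ θ)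
    (heig : ∀ (μ : ℝ) (h : V → ℝ), 0 < μ → μ < (d : ℝ) - τ.card → (∃ x, h x ≠ 0) →
      (∀ x, K.linkVertexWeight τ x = 0 → h x = 0) → ∑ x, K.linkVertexWeight τ x * h x = 0 →
      (∀ x, ∑ y, K.linkEdgeWeight τ x y * h y = μ * (K.linkVertexWeight τ x * h x)) → μ ≤ θ)
    (g : V → ℝ) : K.linkForm τ g ≤ θ * ∑ x, K.linkVertexWeight τ x * g x ^ 2 :=
  walkForm_le_of_eigenvalue_le (linkVertexWeight_nonneg τ) (linkEdgeWeight_comm τ)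
    (fun _ y => linkEdgeWeight_eq_zero y) (linkEdgeWeight_nonneg τ) (faceWeight_pos_iff.2 hτ) hθ
    (sum_linkEdgeWeight τ) (sum_linkVertexWeight τ) (linkEdgeWeight_connected hconn hτ hcard)
    heig g

theorem walkMatrix_mulVec {τ : Finset V} (hτ : K.IsFace τ) (h : V → ℝ) (x : V) :
    (K.walkMatrix τ).mulVec h x = (∑ y, K.linkEdgeWeight τ x y * h y) /
      (((d : ℝ) - τ.card) * K.linkVertexWeight τ x) := by
  have hW := (faceWeight_pos_iff.2 hτ).ne'
  simp only [Matrix.mulVec, dotProduct, walkMatrix, Matrix.of_apply, linkWeight_eq]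
  rw [← sum_div, sum_linkEdgeWeight, sum_div]
  refine sum_congr rfl fun y _ => ?_
  rw [div_div_div_cancel_right₀ hW]
  ring

theorem mem_spectrum_iff_exists_mulVec {n : Type*} [Fintype n] [DecidableEq n]
    (P : Matrix n n ℝ) (μ : ℝ) :
    μ ∈ spectrum ℝ P ↔ ∃ h : n → ℝ, h ≠ 0 ∧ P.mulVec h = μ • h := by
  rw [← Matrix.spectrum_toLin', ← Module.End.hasEigenvalue_iff_mem_spectrum]
  constructor
  · intro h
    obtain ⟨v, hv⟩ := h.exists_hasEigenvector
    exact ⟨v, hv.2, by simpa using hv.apply_eq_smul⟩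
  · rintro ⟨v, hv, h⟩
    exact Module.End.hasEigenvalue_of_hasEigenvector
      ⟨Module.End.mem_eigenspace_iff.2 (by simpa using h), hv⟩

theorem eigenvalue_le_lambda2 {τ : Finset V} (hτ : K.IsFace τ) {μ : ℝ} {h : V → ℝ}
    (hμ : μ < (d : ℝ) - τ.card) (hμ0 : 0 < μ) (hne : ∃ x, h x ≠ 0)
    (hsupp : ∀ x, K.linkVertexWeight τ x = 0 → h x = 0)
    (heq : ∀ x, ∑ y, K.linkEdgeWeight τ x y * h y = μ * (K.linkVertexWeight τ x * h x)) :
    μ ≤ ((d : ℝ) - τ.card) * lambda2 (K.walkMatrix τ) := by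
  have hr : 0 < (d : ℝ) - τ.card := hμ0.trans hμ
  rw [mul_comm, ← div_le_iff₀ hr]
  refine le_csSup ⟨1, fun μ hμ => hμ.1.le⟩ ⟨(div_lt_one hr).2 hμ, ?_⟩
  rw [mem_spectrum_iff_exists_mulVec]
  obtain ⟨x₀, hx₀⟩ := hne
  refine ⟨h, fun h0 => hx₀ (congrFun h0 x₀), ?_⟩
  ext x
  rw [walkMatrix_mulVec hτ, heq]
  by_cases hx : K.linkVertexWeight τ x = 0
  · simp [hsupp x hx]
  · simp only [Pi.smul_apply, smul_eq_mul]
    field_simp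

theorem lambda2_le {τ : Finset V} (hτ : K.IsFace τ) (hcard : τ.card < d) {θ : ℝ}
    (hθ : 0 ≤ θ) (hform : ∀ g, K.linkForm τ g ≤ θ * ∑ x, K.linkVertexWeight τ x * g x ^ 2) :
    lambda2 (K.walkMatrix τ) ≤ θ / ((d : ℝ) - τ.card) := by
  have hr : 0 < (d : ℝ) - τ.card := by
    have : (τ.card : ℝ) < d := by exact_mod_cast hcard
    linarith
  refine Real.sSup_le ?_ (by positivity)
  rintro μ ⟨hμ1, hμ⟩
  rcases le_or_gt μ 0 with h0 | h0
  · exact h0.trans (by positivity)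
  obtain ⟨h, hne, heq⟩ := (mem_spectrum_iff_exists_mulVec _ _).1 hμ
  have heq' : ∀ x, (∑ y, K.linkEdgeWeight τ x y * h y) /
      (((d : ℝ) - τ.card) * K.linkVertexWeight τ x) = μ * h x := by
    intro x
    rw [← walkMatrix_mulVec hτ, heq]
    rfl
  have hsupp : ∀ x, K.linkVertexWeight τ x = 0 → h x = 0 := by
    intro x hx
    have := heq' x
    rw [hx, mul_zero, div_zero] at this
    exact (mul_eq_zero.1 this.symm).resolve_left h0.ne'
  have heig : ∀ x, ∑ y, K.linkEdgeWeight τ x y * h y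
      = (((d : ℝ) - τ.card) * μ) * (K.linkVertexWeight τ x * h x) := by
    intro x
    by_cases hx : K.linkVertexWeight τ x = 0
    · rw [hx, zero_mul, mul_zero]
      exact sum_eq_zero fun y _ => by rw [linkEdgeWeight_eq_zero y hx, zero_mul]
    · have := heq' x
      rw [div_eq_iff (mul_ne_zero hr.ne' hx)] at this
      rw [this]
      ring
  have hsum : ∑ x, K.linkVertexWeight τ x * h x = 0 := by
    have h1 : ∑ x, ∑ y, K.linkEdgeWeight τ x y * h y
        = ((d : ℝ) - τ.card) * ∑ x, K.linkVertexWeight τ x * h x := by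
      rw [sum_comm, mul_sum]
      refine sum_congr rfl fun y _ => ?_
      rw [← sum_mul, sum_congr rfl fun x _ => linkEdgeWeight_comm τ x y, sum_linkEdgeWeight]
      ring
    have h2 := sum_congr rfl fun x (_ : x ∈ (univ : Finset V)) => heig x
    rw [h1, ← mul_sum] at h2
    have h3 : (((d : ℝ) - τ.card) * (1 - μ)) * ∑ x, K.linkVertexWeight τ x * h x = 0 := by
      linear_combination h2
    exact (mul_eq_zero.1 h3).resolve_left (mul_ne_zero hr.ne' (by linarith))
  have hn : 0 < ∑ x, K.linkVertexWeight τ x * h x ^ 2 := by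
    obtain ⟨x₀, hx₀⟩ := Function.ne_iff.1 hne
    have hx₀' : h x₀ ≠ 0 := hx₀
    have hw : 0 < K.linkVertexWeight τ x₀ :=
      lt_of_le_of_ne (linkVertexWeight_nonneg _ _) fun hx => hx₀ (hsupp _ hx.symm)
    exact sum_pos' (fun x _ => mul_nonneg (linkVertexWeight_nonneg _ _) (sq_nonneg _))
      ⟨x₀, mem_univ _, mul_pos hw (by positivity)⟩
  have h1 := hform h
  have h2 : ∑ x, h x * ∑ y, K.linkEdgeWeight τ x y * h y
      = (((d : ℝ) - τ.card) * μ) * ∑ x, K.linkVertexWeight τ x * h x ^ 2 := by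
    rw [mul_sum]
    refine sum_congr rfl fun x _ => ?_
    rw [heig]
    ring
  rw [linkForm, hsum, h2] at h1
  rw [le_div_iff₀ hr]
  have h3 : ((d : ℝ) - τ.card) * μ ≤ θ := by
    refine le_of_mul_le_mul_right ?_ hn
    simpa using h1
  linarith

end WeightedComplex

namespace WeightedComplex

open Finset

variable {V : Type*} [Fintype V] [DecidableEq V] {d : ℕ} {K : WeightedComplex V d}

/-- The centred link forms of the faces `insert x τ` sum up to a quadratic expression in the
link form of `τ`. -/
theorem sum_linkForm_insert (τ : Finset V) (g : V → ℝ) :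
    ∑ x ∈ univ \ τ, K.linkForm (insert x τ) g
      = ((d : ℝ) - τ.card - 1) * ∑ x, g x * ∑ y, K.linkEdgeWeight τ x y * g y
        - ∑ x, (∑ y, K.linkEdgeWeight τ x y * g y) ^ 2 / K.linkVertexWeight τ x := by
  simp only [linkForm]
  rw [sum_sub_distrib]
  congr 1
  · rw [sum_comm, mul_sum]
    refine sum_congr rfl fun y _ => ?_
    rw [← mul_sum, sum_comm, mul_left_comm, mul_sum (s := univ) (a := (d : ℝ) - τ.card - 1)]
    congr 1
    refine sum_congr rfl fun z _ => ?_
    rw [← sum_mul, sum_linkEdgeWeight_insert]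
    ring
  · rw [← sum_subset (subset_univ (univ \ τ))]
    · refine sum_congr rfl fun x hx => ?_
      have hx' : x ∉ τ := by simpa using hx
      simp only [linkEdgeWeight_of_notMem hx', linkVertexWeight_of_notMem hx']
    · intro x _ hx
      have hx' : x ∈ τ := by simpa using hx
      simp [linkVertexWeight, hx']

theorem linkForm_sub_const (τ : Finset V) (hτ : K.IsFace τ) (g : V → ℝ) (m : ℝ) :
    K.linkForm τ (fun x => g x - m) + ∑ x, K.linkVertexWeight τ x * (g x - m) ^ 2
      = K.linkForm τ g + ∑ x, K.linkVertexWeight τ x * g x ^ 2 := by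
  have hW := (faceWeight_pos_iff.2 hτ).ne'
  have hrow := sum_linkEdgeWeight (K := K) τ
  have htot := sum_linkVertexWeight (K := K) τ
  set r := (d : ℝ) - τ.card
  have h1 : ∑ x, ∑ y, K.linkEdgeWeight τ x y * g y
      = r * ∑ x, K.linkVertexWeight τ x * g x := by
    rw [sum_comm, mul_sum]
    refine sum_congr rfl fun y _ => ?_
    rw [← sum_mul, sum_congr rfl fun x _ => linkEdgeWeight_comm τ x y, hrow]
    ring
  have h2 : ∑ x, (g x - m) * ∑ y, K.linkEdgeWeight τ x y * (g y - m)
      = ∑ x, g x * ∑ y, K.linkEdgeWeight τ x y * g y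
        - 2 * m * r * ∑ x, K.linkVertexWeight τ x * g x
        + m ^ 2 * r * ∑ x, K.linkVertexWeight τ x := by
    have : ∀ x, (g x - m) * ∑ y, K.linkEdgeWeight τ x y * (g y - m)
        = g x * ∑ y, K.linkEdgeWeight τ x y * g y - m * ∑ y, K.linkEdgeWeight τ x y * g y
          - m * r * (K.linkVertexWeight τ x * g x) + m ^ 2 * r * K.linkVertexWeight τ x := by
      intro x
      simp only [mul_sub, sum_sub_distrib, ← sum_mul, hrow]
      ring
    simp only [this, sum_add_distrib, sum_sub_distrib, ← mul_sum, h1]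
    ring
  have h3 : ∑ x, K.linkVertexWeight τ x * (g x - m)
      = ∑ x, K.linkVertexWeight τ x * g x - m * ∑ x, K.linkVertexWeight τ x := by
    simp only [mul_sub, sum_sub_distrib, ← sum_mul]
    ring
  have h4 : ∑ x, K.linkVertexWeight τ x * (g x - m) ^ 2
      = ∑ x, K.linkVertexWeight τ x * g x ^ 2 - 2 * m * ∑ x, K.linkVertexWeight τ x * g x
        + m ^ 2 * ∑ x, K.linkVertexWeight τ x := by
    simp only [mul_sum, ← sum_sub_distrib, ← sum_add_distrib]
    exact sum_congr rfl fun x _ => by ring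
  simp only [linkForm]
  rw [h2, h3, h4, htot]
  field_simp
  ring

theorem linkForm_le_sub_of_le {τ : Finset V} (hτ : K.IsFace τ) (hcard : τ.card ≤ d) {φ : ℝ}
    (h : ∀ g, K.linkForm τ g ≤ φ * ∑ x, K.linkVertexWeight τ x * g x ^ 2) (g : V → ℝ) :
    K.linkForm τ g ≤ φ * ∑ x, K.linkVertexWeight τ x * g x ^ 2
      - (1 + φ) / ((d : ℝ) - τ.card + 1) *
        ((∑ x, K.linkVertexWeight τ x * g x) ^ 2 / K.faceWeight τ) := by
  have hW := (faceWeight_pos_iff.2 hτ).ne'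
  have hr : 0 < (d : ℝ) - τ.card + 1 := by
    have : (τ.card : ℝ) ≤ d := by exact_mod_cast hcard
    linarith
  have htot := sum_linkVertexWeight (K := K) τ
  set r := (d : ℝ) - τ.card
  set m := (∑ x, K.linkVertexWeight τ x * g x) / ((r + 1) * K.faceWeight τ) with hm
  have h1 := linkForm_sub_const τ hτ g m
  have h2 := h (fun x => g x - m)
  have h4 : ∑ x, K.linkVertexWeight τ x * (g x - m) ^ 2
      = ∑ x, K.linkVertexWeight τ x * g x ^ 2
        - (∑ x, K.linkVertexWeight τ x * g x) ^ 2 / ((r + 1) * K.faceWeight τ) := by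
    have : ∑ x, K.linkVertexWeight τ x * (g x - m) ^ 2
      = ∑ x, K.linkVertexWeight τ x * g x ^ 2 - 2 * m * ∑ x, K.linkVertexWeight τ x * g x
        + m ^ 2 * ∑ x, K.linkVertexWeight τ x := by
      simp only [mul_sum, ← sum_sub_distrib, ← sum_add_distrib]
      exact sum_congr rfl fun x _ => by ring
    rw [this, htot, hm]
    field_simp
    ring
  have h5 : (1 + φ) / (r + 1) *
        ((∑ x, K.linkVertexWeight τ x * g x) ^ 2 / K.faceWeight τ) = (1 + φ) *
        ((∑ x, K.linkVertexWeight τ x * g x) ^ 2 / ((r + 1) * K.faceWeight τ)) := by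
    field_simp
  rw [h5]
  rw [h4] at h1 h2
  linarith

/-- Trickling down a uniform bound from the links of the faces `insert x τ`. -/
theorem linkForm_le_of_uniform_insert (hconn : K.TotallyConnected) {τ : Finset V}
    (hτ : K.IsFace τ) (hcard : τ.card + 2 ≤ d)
    (h : ∀ x ∉ τ, K.IsFace (insert x τ) → ∀ g, K.linkForm (insert x τ) g ≤
      ((d : ℝ) - τ.card - 1) ^ 2 / (3 * ((d : ℝ) - τ.card) - 1) *
        ∑ y, K.linkVertexWeight (insert x τ) y * g y ^ 2) (g : V → ℝ) :
    K.linkForm τ g ≤ ((d : ℝ) - τ.card - 1) / 2 * ∑ x, K.linkVertexWeight τ x * g x ^ 2 := by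
  have hr : 2 ≤ (d : ℝ) - τ.card := by
    have : (τ.card : ℝ) + 2 ≤ d := by exact_mod_cast hcard
    linarith
  refine linkForm_le_of_eigenvalue_le hconn hτ (by omega) (by linarith) ?_ g
  intro μ g hμ0 hμr ⟨x₀, hx₀⟩ hsupp hsum heq
  have hsumle : ∑ x ∈ univ \ τ, K.linkForm (insert x τ) g ≤ ∑ x ∈ univ \ τ,
      (((d : ℝ) - τ.card - 1) ^ 2 / (3 * ((d : ℝ) - τ.card) - 1) *
        ∑ y, K.linkEdgeWeight τ x y * g y ^ 2
        - (1 + ((d : ℝ) - τ.card - 1) ^ 2 / (3 * ((d : ℝ) - τ.card) - 1)) /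
          ((d : ℝ) - τ.card) *
          ((∑ y, K.linkEdgeWeight τ x y * g y) ^ 2 / K.linkVertexWeight τ x)) := by
    refine sum_le_sum fun x hx => ?_
    have hx' : x ∉ τ := by simpa using hx
    by_cases hf : K.IsFace (insert x τ)
    · have h1 := linkForm_le_sub_of_le hf (by rw [card_insert_of_notMem hx']; omega)
        (h x hx' hf) g
      simp only [linkEdgeWeight_of_notMem hx', linkVertexWeight_of_notMem hx']
      rw [card_insert_of_notMem hx'] at h1
      have h2 : (d : ℝ) - (τ.card + 1 : ℕ) + 1 = d - τ.card := by push_cast; ring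
      rwa [h2] at h1
    · have h0 : K.faceWeight (insert x τ) = 0 := by
        by_contra h0
        exact hf (faceWeight_ne_zero_iff.1 h0)
      have h1 := fun y => linkVertexWeight_eq_zero y h0
      have h2 := fun y z => linkEdgeWeight_eq_zero (K := K) z (h1 y)
      simp [linkForm, linkEdgeWeight_of_notMem hx', h1, h2]
  have hext : ∀ F : V → ℝ, (∀ x ∈ τ, F x = 0) → ∑ x ∈ univ \ τ, F x = ∑ x, F x := by
    intro F hF
    refine sum_subset (subset_univ _) fun x _ hx => hF x (by simpa using hx)
  rw [sum_linkForm_insert, hext _ (fun x hx => by simp [linkEdgeWeight, hx]), sum_sub_distrib,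
    ← mul_sum, ← mul_sum] at hsumle
  have hrow := sum_linkEdgeWeight (K := K) τ
  set r := (d : ℝ) - τ.card
  have hN : ∑ x, ∑ y, K.linkEdgeWeight τ x y * g y ^ 2
      = r * ∑ x, K.linkVertexWeight τ x * g x ^ 2 := by
    rw [sum_comm, mul_sum]
    refine sum_congr rfl fun y _ => ?_
    rw [← sum_mul, sum_congr rfl fun x _ => linkEdgeWeight_comm τ x y, hrow]
    ring
  have hB : ∑ x, g x * ∑ y, K.linkEdgeWeight τ x y * g y
      = μ * ∑ x, K.linkVertexWeight τ x * g x ^ 2 := by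
    rw [mul_sum]
    refine sum_congr rfl fun x _ => ?_
    rw [heq]
    ring
  have hC : ∑ x, (∑ y, K.linkEdgeWeight τ x y * g y) ^ 2 / K.linkVertexWeight τ x
      = μ ^ 2 * ∑ x, K.linkVertexWeight τ x * g x ^ 2 := by
    rw [mul_sum]
    refine sum_congr rfl fun x _ => ?_
    rw [heq]
    by_cases hx : K.linkVertexWeight τ x = 0
    · simp [hx]
    · field_simp
  have hn : 0 < ∑ x, K.linkVertexWeight τ x * g x ^ 2 := by
    have hw : 0 < K.linkVertexWeight τ x₀ :=
      lt_of_le_of_ne (linkVertexWeight_nonneg _ _) fun hx => hx₀ (hsupp _ hx.symm)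
    exact sum_pos' (fun x _ => mul_nonneg (linkVertexWeight_nonneg _ _) (sq_nonneg _))
      ⟨x₀, mem_univ _, mul_pos hw (by positivity)⟩
  rw [hN, hB, hC] at hsumle
  have h3 : 0 < 3 * r - 1 := by linarith
  have hr0 : 0 < r := by linarith
  obtain ⟨φ, hφ⟩ : ∃ φ, φ = (r - 1) ^ 2 / (3 * r - 1) := ⟨_, rfl⟩
  have hφ' : φ * (3 * r - 1) = (r - 1) ^ 2 := by rw [hφ, div_mul_cancel₀ _ h3.ne']
  rw [← hφ] at hsumle
  have hmain : (r - 1) * μ - μ ^ 2 ≤ φ * r - (1 + φ) / r * μ ^ 2 := by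
    refine le_of_mul_le_mul_right ?_ hn
    linarith
  have hfac : (r - μ) * (r * (r - 1)) * (2 * μ - (r - 1)) ≤ 0 := by
    have h1 : (r - μ) * (r * (r - 1)) * (2 * μ - (r - 1))
        = (3 * r - 1) * r * ((r - 1) * μ - μ ^ 2 - (φ * r - (1 + φ) / r * μ ^ 2)) := by
      have h2 : r * ((1 + φ) / r * μ ^ 2) = (1 + φ) * μ ^ 2 := by field_simp
      linear_combination (r ^ 2 - μ ^ 2) * hφ' - (3 * r - 1) * h2
    rw [h1]
    exact mul_nonpos_of_nonneg_of_nonpos (by positivity) (by linarith)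
  have hpos : 0 < (r - μ) * (r * (r - 1)) :=
    mul_pos (by linarith) (mul_pos (by linarith) (by linarith))
  have := nonpos_of_mul_nonpos_right hfac hpos
  linarith

end WeightedComplex

namespace PartiteWeightedComplex

open Finset WeightedComplex

variable {V : Type*} [Fintype V] [DecidableEq V] {d : ℕ} {K : PartiteWeightedComplex V d}

theorem vtype_injOn {τ : Finset V} (hτ : K.IsFace τ) : Set.InjOn K.vtype τ := by
  obtain ⟨η, hη, hτη⟩ := hτ
  intro x hx y hy hxy
  obtain ⟨z, hz⟩ := card_eq_one.1 (K.partite η hη (K.vtype y))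
  have h1 : x ∈ η.filter (fun x => K.vtype x = K.vtype y) := mem_filter.2 ⟨hτη hx, hxy⟩
  have h2 : y ∈ η.filter (fun x => K.vtype x = K.vtype y) := mem_filter.2 ⟨hτη hy, rfl⟩
  rw [hz, mem_singleton] at h1 h2
  rw [h1, h2]

theorem exists_vtype_eq {η : Finset V} (hη : η ∈ K.facets) (i : Fin (d + 1)) :
    ∃ x ∈ η, K.vtype x = i := by
  obtain ⟨z, hz⟩ := card_eq_one.1 (K.partite η hη i)
  have h1 : z ∈ η.filter (fun x => K.vtype x = i) := by simp [hz]
  exact ⟨z, (mem_filter.1 h1).1, (mem_filter.1 h1).2⟩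

theorem card_image_vtype {τ : Finset V} (hτ : K.IsFace τ) :
    (τ.image K.vtype).card = τ.card := card_image_of_injOn (vtype_injOn hτ)

theorem vtype_notMem_image {τ : Finset V} {x : V} (hx : x ∉ τ) (hτ : K.IsFace (insert x τ)) :
    K.vtype x ∉ τ.image K.vtype := by
  intro h
  obtain ⟨y, hy, hyx⟩ := mem_image.1 h
  have := vtype_injOn hτ (mem_insert_of_mem hy) (mem_insert_self x τ) hyx
  exact hx (this ▸ hy)

theorem sum_linkVertexWeight_mul_vtype (τ : Finset V) (ψ : Fin (d + 1) → ℝ) :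
    ∑ x, K.linkVertexWeight τ x * ψ (K.vtype x)
      = K.faceWeight τ * ∑ j ∈ univ \ τ.image K.vtype, ψ j := by
  rw [sum_linkVertexWeight_mul τ (fun x => ψ (K.vtype x)), faceWeight, sum_mul]
  refine sum_congr rfl fun η hη => ?_
  obtain ⟨hη, hτ⟩ := mem_filter.1 hη
  have hinj := vtype_injOn (K := K) ⟨η, hη, Subset.rfl⟩
  rw [← sum_image (f := ψ) (g := K.vtype) (hinj.mono (coe_subset.2 sdiff_subset))]
  congr 2
  ext i
  simp only [mem_image, mem_sdiff, mem_univ, true_and]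
  constructor
  · rintro ⟨x, ⟨hx, hxτ⟩, rfl⟩ ⟨y, hy, hyx⟩
    exact hxτ (hinj (hτ hy) hx hyx ▸ hy)
  · intro h
    obtain ⟨x, hx, rfl⟩ := exists_vtype_eq hη i
    exact ⟨x, ⟨hx, fun hxτ => h ⟨x, hxτ, rfl⟩⟩, rfl⟩

theorem sum_linkEdgeWeight_mul_vtype (τ : Finset V) (x : V) (ψ : Fin (d + 1) → ℝ) :
    ∑ y, K.linkEdgeWeight τ x y * ψ (K.vtype y) = K.linkVertexWeight τ x *
      ∑ j ∈ univ \ insert (K.vtype x) (τ.image K.vtype), ψ j := by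
  by_cases hx : x ∈ τ
  · simp [linkEdgeWeight, linkVertexWeight, hx]
  · simp only [linkEdgeWeight_of_notMem hx, linkVertexWeight_of_notMem hx]
    rw [sum_linkVertexWeight_mul_vtype, image_insert]

theorem linkEdgeWeight_eq_zero_of_vtype_eq (τ : Finset V) {x y : V}
    (h : K.vtype x = K.vtype y) : K.linkEdgeWeight τ x y = 0 := by
  by_contra h0
  obtain ⟨hxy, hx, hy, hf⟩ := linkEdgeWeight_ne_zero_iff.1 h0
  exact hxy (vtype_injOn hf (by simp) (by simp) h)

/-- Trickling down a diagonal bound from the links of the faces `insert x τ`. -/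
theorem linkForm_le_of_insert (hconn : K.TotallyConnected) {τ : Finset V}
    (hτ : K.IsFace τ) (hcard : τ.card + 2 ≤ d)
    {φ : Fin (d + 1) → Fin (d + 1) → ℝ} {F : Fin (d + 1) → ℝ}
    (hφ : ∀ j ∉ τ.image K.vtype, ∀ i, φ j i ≤
      ((d : ℝ) - τ.card - 1) ^ 2 / (3 * ((d : ℝ) - τ.card) - 1))
    (hF : ∀ i ∉ τ.image K.vtype, ∑ j ∈ univ \ insert i (τ.image K.vtype), φ j i ≤
      ((d : ℝ) - τ.card - 1) * F i - F i ^ 2)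
    (h : ∀ x ∉ τ, K.IsFace (insert x τ) → ∀ g, K.linkForm (insert x τ) g ≤
      ∑ y, K.linkVertexWeight (insert x τ) y * φ (K.vtype x) (K.vtype y) * g y ^ 2)
    (g : V → ℝ) :
    K.linkForm τ g ≤ ∑ x, K.linkVertexWeight τ x * F (K.vtype x) * g x ^ 2 := by
  have hbd := linkForm_le_of_uniform_insert hconn hτ hcard (fun x hx hf g =>
    (h x hx hf g).trans (by
      rw [mul_sum]
      refine sum_le_sum fun y _ => ?_
      have h1 := hφ (K.vtype x) (vtype_notMem_image hx hf) (K.vtype y)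
      have h2 : 0 ≤ K.linkVertexWeight (insert x τ) y * g y ^ 2 :=
        mul_nonneg (linkVertexWeight_nonneg _ _) (sq_nonneg _)
      nlinarith [mul_le_mul_of_nonneg_left h1 h2]))
  refine walkForm_le_of_quadratic_le (linkVertexWeight_nonneg τ) (linkEdgeWeight_comm τ)
    (fun _ y => linkEdgeWeight_eq_zero y) (F := fun x => F (K.vtype x))
    (faceWeight_pos_iff.2 hτ) (sum_linkEdgeWeight τ) (sum_linkVertexWeight τ) ?_ hbd g
  intro g
  rw [← sum_linkForm_insert]
  calc ∑ x ∈ univ \ τ, K.linkForm (insert x τ) g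
      ≤ ∑ x ∈ univ \ τ, ∑ y, K.linkEdgeWeight τ x y * φ (K.vtype x) (K.vtype y) * g y ^ 2 := by
        refine sum_le_sum fun x hx => ?_
        have hx' : x ∉ τ := by simpa using hx
        by_cases hf : K.IsFace (insert x τ)
        · simp only [linkEdgeWeight_of_notMem hx']
          exact h x hx' hf g
        · have h0 : K.faceWeight (insert x τ) = 0 := by
            by_contra h0
            exact hf (faceWeight_ne_zero_iff.1 h0)
          have h1 := fun y => linkVertexWeight_eq_zero y h0
          have h2 := fun y z => linkEdgeWeight_eq_zero (K := K.toWeightedComplex) z (h1 y)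
          simp [linkForm, linkEdgeWeight_of_notMem hx', h1, h2]
    _ = ∑ x, ∑ y, K.linkEdgeWeight τ x y * φ (K.vtype x) (K.vtype y) * g y ^ 2 := by
        refine sum_subset (subset_univ _) fun x _ hx => ?_
        have hx' : x ∈ τ := by simpa using hx
        simp [linkEdgeWeight, hx']
    _ = ∑ y, K.linkVertexWeight τ y *
          (∑ j ∈ univ \ insert (K.vtype y) (τ.image K.vtype), φ j (K.vtype y)) * g y ^ 2 := by
        rw [sum_comm]
        refine sum_congr rfl fun y _ => ?_
        rw [← sum_mul, ← sum_linkEdgeWeight_mul_vtype τ y (fun j => φ j (K.vtype y))]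
        congr 1
        exact sum_congr rfl fun x _ => by rw [linkEdgeWeight_comm]
    _ ≤ _ := by
        refine sum_le_sum fun y _ => ?_
        by_cases hy : K.linkVertexWeight τ y = 0
        · simp [hy]
        obtain ⟨h1, h2⟩ := linkVertexWeight_ne_zero_iff.1 hy
        exact mul_le_mul_of_nonneg_right (mul_le_mul_of_nonneg_left
          (hF _ (vtype_notMem_image h1 h2)) (linkVertexWeight_nonneg _ _)) (sq_nonneg _)

/-- A function that is constant along the edges of the link of `τ` between vertices with type in
`J` is constant on all such vertices, provided `J` has at least two elements. -/
theorem eq_of_eq_on_linkEdges (hconn : K.TotallyConnected) {α : Type*} {J : Finset (Fin (d + 1))}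
    (hJ : 2 ≤ J.card) (q : V → α) {τ : Finset V} (hτ : K.IsFace τ)
    (hdisj : Disjoint J (τ.image K.vtype))
    (hq : ∀ y y', K.vtype y ∈ J → K.vtype y' ∈ J → K.linkEdgeWeight τ y y' ≠ 0 → q y = q y')
    {y y' : V} (hy : K.vtype y ∈ J) (hy' : K.vtype y' ∈ J)
    (hwy : K.linkVertexWeight τ y ≠ 0) (hwy' : K.linkVertexWeight τ y' ≠ 0) : q y = q y' := by
  induction hn : (univ \ (J ∪ τ.image K.vtype)).card using Nat.strong_induction_on
    generalizing τ y y' with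
  | _ n ih =>
  have hcard : τ.card + 2 ≤ d + 1 := by
    have h1 := card_union_of_disjoint hdisj
    have h2 := card_le_univ (J ∪ τ.image K.vtype)
    rw [h1, card_image_vtype hτ, Fintype.card_fin] at h2
    omega
  have hnotMem : ∀ z, K.vtype z ∈ J → z ∉ τ := fun z hz hzτ =>
    disjoint_left.1 hdisj hz (mem_image_of_mem _ hzτ)
  have main : ∀ z, Relation.ReflTransGen (fun a b => 0 < K.linkEdgeWeight τ a b) y z →
      ∀ y', K.vtype y' ∈ J → (y' = z ∨ K.linkEdgeWeight τ z y' ≠ 0) → q y' = q y := by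
    intro z hz
    induction hz with
    | refl =>
      rintro y' hy' (rfl | h)
      · rfl
      · exact (hq _ _ hy hy' h).symm
    | @tail z z' _ hzz' ih' =>
      intro y' hy' h
      obtain ⟨hne, hzτ, hz'τ, η, hη, hsub⟩ := linkEdgeWeight_ne_zero_iff.1 hzz'.ne'
      obtain ⟨j, hj⟩ : J.Nonempty := card_pos.1 (by omega)
      obtain ⟨y₀, hy₀, rfl⟩ := exists_vtype_eq hη j
      simp only [insert_subset_iff] at hsub
      obtain ⟨hzη, hz'η, hτη⟩ := hsub
      have hedge : ∀ a ∈ η, a ∉ τ → y₀ = a ∨ K.linkEdgeWeight τ a y₀ ≠ 0 := by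
        intro a ha haτ
        by_cases hay : y₀ = a
        · exact Or.inl hay
        · exact Or.inr (linkEdgeWeight_ne_zero_iff.2 ⟨Ne.symm hay, haτ, hnotMem _ hj, η, hη,
            by simp [insert_subset_iff, ha, hy₀, hτη]⟩)
      rw [← ih' y₀ hj (hedge z hzη hzτ)]
      have h₀ := hedge z' hz'η hz'τ
      by_cases hz'J : K.vtype z' ∈ J
      · have hto : ∀ a, K.vtype a ∈ J → (a = z' ∨ K.linkEdgeWeight τ z' a ≠ 0) → q a = q z' := by
          rintro a ha (rfl | h)
          · rfl
          · exact (hq _ _ hz'J ha h).symm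
        rw [hto y' hy' h, hto y₀ hj h₀]
      · have hto : ∀ a, K.vtype a ∈ J → (a = z' ∨ K.linkEdgeWeight τ z' a ≠ 0) →
            K.linkVertexWeight (insert z' τ) a ≠ 0 := by
          rintro a ha (rfl | h)
          · exact absurd ha hz'J
          · rwa [linkEdgeWeight_of_notMem hz'τ] at h
        have hf : K.IsFace (insert z' τ) := ⟨η, hη, by simp [insert_subset_iff, hz'η, hτη]⟩
        have htz' := vtype_notMem_image hz'τ hf
        refine ih _ ?_ hf ?_ ?_ hy' hj (hto y' hy' h) (hto y₀ hj h₀) rfl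
        · rw [← hn]
          refine card_lt_card (ssubset_iff_of_subset ?_ |>.2 ⟨K.vtype z', ?_, ?_⟩)
          · refine sdiff_subset_sdiff Subset.rfl (union_subset_union Subset.rfl ?_)
            exact image_subset_image (subset_insert _ _)
          · simp only [mem_sdiff, mem_univ, mem_union, true_and]
            tauto
          · simp
        · rw [image_insert, disjoint_insert_right]
          exact ⟨hz'J, hdisj⟩
        · intro a b ha hb hab
          refine hq a b ha hb ?_
          obtain ⟨h1, h2, h3, h4⟩ := linkEdgeWeight_ne_zero_iff.1 hab
          refine linkEdgeWeight_ne_zero_iff.2 ⟨h1, hnotMem a ha, hnotMem b hb, h4.mono ?_⟩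
          exact insert_subset_insert _ (insert_subset_insert _ (subset_insert _ _))
  exact (main y' (linkEdgeWeight_connected hconn hτ hcard y y' hwy hwy') y' hy' (Or.inl rfl)).symm

theorem gAdj_comm {i j : Fin (d + 1)} : K.gAdj i j ↔ K.gAdj j i := by
  unfold gAdj eps
  rw [pair_comm, ne_comm]

/-- For a face of type `[d] ∖ {i, j}` with `i`, `j` non-adjacent, the link is a product. -/
theorem faceWeight_mul_of_not_gAdj (hconn : K.TotallyConnected) {τ : Finset V}
    (hτ : K.IsFace τ) {i j : Fin (d + 1)} (hij : i ≠ j)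
    (himg : τ.image K.vtype = univ \ {i, j}) (hadj : ¬ K.gAdj i j) {x y : V}
    (hx : K.vtype x = i) (hy : K.vtype y = j) :
    K.faceWeight (insert x (insert y τ)) * K.faceWeight τ
      = K.faceWeight (insert x τ) * K.faceWeight (insert y τ) := by
  have hW := faceWeight_pos_iff.2 hτ
  have heps : K.eps i j ≤ 0 := by
    by_contra h
    exact hadj ⟨hij, not_le.1 h⟩
  have hl : lambda2 (K.walkMatrix τ) ≤ 0 := by
    refine le_trans ?_ heps
    unfold eps
    refine le_csSup ?_ ⟨τ, hτ, himg, rfl⟩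
    refine (Set.Finite.subset (Set.finite_range fun τ => lambda2 (K.walkMatrix τ)) ?_).bddAbove
    rintro r ⟨σ, -, -, rfl⟩
    exact ⟨σ, rfl⟩
  have hcard : τ.card + 2 = d + 1 := by
    have h1 := card_image_vtype hτ
    rw [himg, card_sdiff_of_subset (subset_univ _), card_pair hij, card_univ,
      Fintype.card_fin] at h1
    have h2 := card_le_univ ({i, j} : Finset (Fin (d + 1)))
    rw [card_pair hij, Fintype.card_fin] at h2
    omega
  have hform : ∀ g, K.linkForm τ g ≤ 0 := by
    intro g
    have := linkForm_le_of_eigenvalue_le hconn hτ hcard.le le_rfl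
      (fun μ h hμ0 hμr hne hsupp _ heq =>
        (eigenvalue_le_lambda2 hτ hμr hμ0 hne hsupp heq).trans
          (mul_nonpos_of_nonneg_of_nonpos (hμ0.trans hμr).le hl)) g
    simpa using this
  have hxτ : x ∉ τ := fun h => by
    have := mem_image_of_mem K.vtype h
    simp [himg, hx] at this
  have hyτ : y ∉ τ := fun h => by
    have := mem_image_of_mem K.vtype h
    simp [himg, hy] at this
  have hi : i ∉ τ.image K.vtype := by simp [himg]
  have hj : j ∉ τ.image K.vtype := by simp [himg]
  have hxy : x ≠ y := fun h => hij (by rw [← hx, ← hy, h])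
  set w := K.linkVertexWeight τ with hw
  set c := K.linkEdgeWeight τ with hc
  have hwx : K.faceWeight (insert x τ) = w x := (linkVertexWeight_of_notMem hxτ).symm
  have hwy : K.faceWeight (insert y τ) = w y := (linkVertexWeight_of_notMem hyτ).symm
  have hcxy : K.faceWeight (insert x (insert y τ)) = c x y := by
    rw [hc, linkEdgeWeight_eq, if_neg (by tauto)]
  rw [hwx, hwy, hcxy]
  set W := K.faceWeight τ
  have hws : ∀ k, k ∉ τ.image K.vtype → ∑ a, w a * (if K.vtype a = k then 1 else 0) = W := by
    intro k hk
    rw [sum_linkVertexWeight_mul_vtype τ (fun l => if l = k then (1 : ℝ) else 0),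
      sum_ite_eq', if_pos (by simpa using hk), mul_one]
  have hcs : ∀ a k, k ∉ τ.image K.vtype → K.vtype a ≠ k →
      ∑ b, c a b * (if K.vtype b = k then 1 else 0) = w a := by
    intro a k hk hak
    rw [sum_linkEdgeWeight_mul_vtype τ a (fun l => if l = k then (1 : ℝ) else 0),
      sum_ite_eq', if_pos (mem_sdiff.2
        ⟨mem_univ _, fun h => (mem_insert.1 h).elim (Ne.symm hak) hk⟩), mul_one]
  let ind : Fin (d + 1) → V → ℝ := fun k a => if K.vtype a = k then 1 else 0
  let u : V → ℝ := fun a => (if a = x then 1 else 0) - w x / W * ind i a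
  let v : V → ℝ := fun a => (if a = y then 1 else 0) - w y / W * ind j a
  have hu0 : ∀ a, K.vtype a ≠ i → u a = 0 := by
    intro a ha
    have : a ≠ x := fun h => ha (h ▸ hx)
    simp [u, ind, ha, this]
  have hv0 : ∀ a, K.vtype a ≠ j → v a = 0 := by
    intro a ha
    have : a ≠ y := fun h => ha (h ▸ hy)
    simp [v, ind, ha, this]
  have hself : ∀ (k : Fin (d + 1)) (f : V → ℝ), (∀ a, K.vtype a ≠ k → f a = 0) →
      ∑ a, f a * ∑ b, c a b * f b = 0 := by
    intro k f hf
    refine sum_eq_zero fun a _ => ?_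
    by_cases ha : K.vtype a = k
    · rw [sum_eq_zero, mul_zero]
      intro b _
      by_cases hb : K.vtype b = k
      · rw [hc, linkEdgeWeight_eq_zero_of_vtype_eq τ (ha.trans hb.symm), zero_mul]
      · rw [hf b hb, mul_zero]
    · rw [hf a ha, zero_mul]
  have hwu : ∑ a, w a * u a = 0 := by
    have h1 := hws i hi
    simp only [u, ind, mul_sub, sum_sub_distrib, mul_left_comm (w _), ← mul_sum, h1]
    simp [div_mul_cancel₀ _ hW.ne']
  have hwv : ∑ a, w a * v a = 0 := by
    have h1 := hws j hj
    simp only [v, ind, mul_sub, sum_sub_distrib, mul_left_comm (w _), ← mul_sum, h1]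
    simp [div_mul_cancel₀ _ hW.ne']
  have hcross : ∑ a, u a * ∑ b, c a b * v b = c x y - w x * w y / W := by
    have h1 : ∀ a, u a * ∑ b, c a b * v b = u a * c a y - w y / W * (w a * u a) := by
      intro a
      by_cases ha : K.vtype a = i
      · have h2 := hcs a j hj (by rw [ha]; exact hij)
        simp only [v, ind, mul_sub, sum_sub_distrib, mul_left_comm (c _ _), ← mul_sum, h2]
        simp
        ring
      · simp [hu0 a ha]
    have h3 : ∑ a, u a * c a y = c x y - w x / W * w y := by
      have h4 := hcs y i hi (by rw [hy]; exact hij.symm)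
      have h5 : ∀ a, u a * c a y = (if a = x then c a y else 0)
          - w x / W * (c y a * (if K.vtype a = i then 1 else 0)) := by
        intro a
        simp only [u, ind, hc]
        rw [linkEdgeWeight_comm τ y a]
        split_ifs <;> ring
      simp only [h5, sum_sub_distrib, ← mul_sum, h4]
      simp
    simp only [h1, sum_sub_distrib, ← mul_sum, hwu, h3]
    ring
  have hcross' : ∑ a, v a * ∑ b, c a b * u b = c x y - w x * w y / W := by
    rw [← hcross]
    simp only [mul_sum]
    rw [sum_comm]
    refine sum_congr rfl fun a _ => sum_congr rfl fun b _ => ?_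
    rw [hc, linkEdgeWeight_comm]
    ring
  have hval : ∀ s : ℝ, K.linkForm τ (fun a => u a + s * v a)
      = 2 * s * (c x y - w x * w y / W) := by
    intro s
    have h1 : ∑ a, w a * (u a + s * v a) = 0 := by
      simp only [mul_add, sum_add_distrib, mul_left_comm (w _), ← mul_sum, hwu, hwv]
      simp
    have h2 : ∑ a, (u a + s * v a) * ∑ b, c a b * (u b + s * v b)
        = ∑ a, u a * ∑ b, c a b * u b + s * ∑ a, u a * ∑ b, c a b * v b
          + s * ∑ a, v a * ∑ b, c a b * u b + s ^ 2 * ∑ a, v a * ∑ b, c a b * v b := by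
      have hin : ∀ a, ∑ b, c a b * (u b + s * v b)
          = ∑ b, c a b * u b + s * ∑ b, c a b * v b := by
        intro a
        rw [mul_sum, ← sum_add_distrib]
        exact sum_congr rfl fun b _ => by ring
      rw [mul_sum univ _ s, mul_sum univ _ s, mul_sum univ _ (s ^ 2), ← sum_add_distrib,
        ← sum_add_distrib, ← sum_add_distrib]
      exact sum_congr rfl fun a _ => by rw [hin]; ring
    unfold linkForm
    rw [h1, h2, hself i u hu0, hself j v hv0, hcross, hcross']
    ring
  have h1 := hform (fun a => u a + 1 * v a)
  have h2 := hform (fun a => u a + (-1) * v a)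
  rw [hval] at h1 h2
  have h3 : c x y = w x * w y / W := by linarith
  rw [h3, div_mul_cancel₀ _ hW.ne']

/-- If `x` is independent of the vertices with type in `J` in the links of all `insert y τ` with
`vtype y ∈ J`, then the same holds in the link of `τ`. -/
theorem faceWeight_mul_of_insert (hconn : K.TotallyConnected) {τ : Finset V} (hτ : K.IsFace τ)
    {J : Finset (Fin (d + 1))} (hJ : 2 ≤ J.card) (hdisj : Disjoint J (τ.image K.vtype)) {x : V}
    (hxτ : x ∉ τ) (hxJ : K.vtype x ∉ J)
    (h : ∀ y y', K.vtype y ∈ J → K.vtype y' ∈ J.erase (K.vtype y) → K.IsFace (insert y τ) →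
      K.faceWeight (insert x (insert y' (insert y τ))) * K.faceWeight (insert y τ)
        = K.faceWeight (insert x (insert y τ)) * K.faceWeight (insert y' (insert y τ)))
    {y : V} (hy : K.vtype y ∈ J) :
    K.faceWeight (insert x (insert y τ)) * K.faceWeight τ
      = K.faceWeight (insert x τ) * K.faceWeight (insert y τ) := by
  by_cases hy0 : K.faceWeight (insert y τ) = 0
  · rw [hy0, faceWeight_eq_zero_of_subset (subset_insert x _) hy0]
    ring
  have hnotMem : ∀ z, K.vtype z ∈ J → z ∉ τ := fun z hz hzτ =>
    disjoint_left.1 hdisj hz (mem_image_of_mem _ hzτ)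
  let q : V → ℝ := fun y => K.faceWeight (insert x (insert y τ)) / K.faceWeight (insert y τ)
  have hq : ∀ y y', K.vtype y ∈ J → K.vtype y' ∈ J → K.linkEdgeWeight τ y y' ≠ 0 →
      q y = q y' := by
    intro a b ha hb hab
    obtain ⟨hne, haτ, hbτ, hf⟩ := linkEdgeWeight_ne_zero_iff.1 hab
    have hfa : K.IsFace (insert a τ) :=
      hf.mono (insert_subset_insert _ (subset_insert _ _))
    have hfb : K.IsFace (insert b τ) := hf.mono (subset_insert _ _)
    have htype : K.vtype a ≠ K.vtype b := fun hE => hne (vtype_injOn hf (by simp) (by simp) hE)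
    have h1 := h a b ha (mem_erase.2 ⟨htype.symm, hb⟩) hfa
    have h2 := h b a hb (mem_erase.2 ⟨htype, ha⟩) hfb
    rw [insert_comm b a τ] at h1
    have hE := faceWeight_ne_zero_iff.2 hf
    have hA := faceWeight_ne_zero_iff.2 hfa
    have hB := faceWeight_ne_zero_iff.2 hfb
    have e1 : q a = K.faceWeight (insert x (insert a (insert b τ)))
        / K.faceWeight (insert a (insert b τ)) := by
      rw [div_eq_div_iff hA hE]
      exact h1.symm
    have e2 : q b = K.faceWeight (insert x (insert a (insert b τ)))
        / K.faceWeight (insert a (insert b τ)) := by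
      rw [div_eq_div_iff hB hE]
      exact h2.symm
    rw [e1, e2]
  have hconst : ∀ y', K.vtype y' ∈ J →
      K.faceWeight (insert x (insert y' τ)) = q y * K.faceWeight (insert y' τ) := by
    intro y' hy'
    by_cases h0 : K.faceWeight (insert y' τ) = 0
    · rw [h0, faceWeight_eq_zero_of_subset (subset_insert x _) h0, mul_zero]
    · have := eq_of_eq_on_linkEdges hconn hJ q hτ hdisj hq hy hy'
        (by rwa [linkVertexWeight_of_notMem (hnotMem y hy)])
        (by rwa [linkVertexWeight_of_notMem (hnotMem y' hy')])
      rw [this, div_mul_cancel₀ _ h0]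
  have hjτ : K.vtype y ∉ τ.image K.vtype := disjoint_left.1 hdisj hy
  have hsum : K.faceWeight (insert x τ) = q y * K.faceWeight τ := by
    let ψ : Fin (d + 1) → ℝ := fun l => if l = K.vtype y then 1 else 0
    have h1 : ∑ z, K.linkEdgeWeight τ x z * ψ (K.vtype z) = K.faceWeight (insert x τ) := by
      rw [sum_linkEdgeWeight_mul_vtype τ x ψ, sum_ite_eq', if_pos, mul_one,
        linkVertexWeight_of_notMem hxτ]
      exact mem_sdiff.2 ⟨mem_univ _, fun h => (mem_insert.1 h).elim
        (fun h => hxJ (h ▸ hy)) hjτ⟩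
    have h2 : ∑ z, K.linkVertexWeight τ z * ψ (K.vtype z) = K.faceWeight τ := by
      rw [sum_linkVertexWeight_mul_vtype τ ψ, sum_ite_eq', if_pos (by simpa using hjτ), mul_one]
    rw [← h1, ← h2, mul_sum]
    refine sum_congr rfl fun z _ => ?_
    by_cases hz : K.vtype z = K.vtype y
    · have hzJ : K.vtype z ∈ J := hz ▸ hy
      have hxz : x ≠ z := fun h => hxJ (h ▸ hzJ)
      rw [linkVertexWeight_of_notMem (hnotMem z hzJ), linkEdgeWeight_eq,
        if_neg (by have := hnotMem z hzJ; tauto), hconst z hzJ]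
      ring
    · simp [ψ, hz]
  rw [hsum, hconst y hy]
  ring

theorem erase_union_eq_sdiff_image_insert {τ : Finset V} {I J : Finset (Fin (d + 1))}
    (hdisj : Disjoint I J) (hunion : I ∪ J = univ \ τ.image K.vtype) {x : V}
    (hx : K.vtype x ∈ I) : I.erase (K.vtype x) ∪ J = univ \ (insert x τ).image K.vtype := by
  have hxJ : K.vtype x ∉ J := disjoint_left.1 hdisj hx
  rw [image_insert]
  ext i
  have := congrArg (fun s => i ∈ s) hunion
  simp only [mem_union, mem_sdiff, mem_univ, true_and, eq_iff_iff] at this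
  simp only [mem_union, mem_erase, mem_sdiff, mem_univ, true_and, mem_insert]
  by_cases hi : i = K.vtype x
  · subst hi
    simp [hxJ]
  · tauto

/-- In the link of a face `τ`, vertices whose types lie in different classes of a partition of
the remaining types without adjacencies between the classes are independent. -/
theorem faceWeight_mul_of_separated (hconn : K.TotallyConnected) {τ : Finset V}
    (hτ : K.IsFace τ) {I J : Finset (Fin (d + 1))} (hdisj : Disjoint I J)
    (hunion : I ∪ J = univ \ τ.image K.vtype) (hadj : ∀ i ∈ I, ∀ j ∈ J, ¬ K.gAdj i j) {x y : V}
    (hx : K.vtype x ∈ I) (hy : K.vtype y ∈ J) :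
    K.faceWeight (insert x (insert y τ)) * K.faceWeight τ
      = K.faceWeight (insert x τ) * K.faceWeight (insert y τ) := by
  induction hn : I.card + J.card using Nat.strong_induction_on generalizing τ I J x y with
  | _ n ih =>
  have hI : ∀ i ∈ I, i ∉ τ.image K.vtype := fun i hi =>
    (mem_sdiff.1 (hunion ▸ mem_union_left J hi)).2
  have hJ : ∀ j ∈ J, j ∉ τ.image K.vtype := fun j hj =>
    (mem_sdiff.1 (hunion ▸ mem_union_right I hj)).2
  have hxτ : x ∉ τ := fun h => hI _ hx (mem_image_of_mem _ h)
  have hyτ : y ∉ τ := fun h => hJ _ hy (mem_image_of_mem _ h)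
  have hstep : ∀ {I J : Finset (Fin (d + 1))}, I.card + J.card = n → Disjoint I J →
      I ∪ J = univ \ τ.image K.vtype → (∀ i ∈ I, ∀ j ∈ J, ¬ K.gAdj i j) → 2 ≤ J.card →
      ∀ {x y : V}, x ∉ τ → K.vtype x ∈ I → K.vtype y ∈ J →
      K.faceWeight (insert x (insert y τ)) * K.faceWeight τ
        = K.faceWeight (insert x τ) * K.faceWeight (insert y τ) := by
    intro I J hn hdisj hunion hadj hJ2 x y hxτ hx hy
    refine faceWeight_mul_of_insert hconn hτ hJ2 ?_ hxτ (disjoint_left.1 hdisj hx) ?_ hy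
    · rw [disjoint_left]
      exact fun j hj => (mem_sdiff.1 (hunion ▸ mem_union_right I hj)).2
    · intro a b ha hb hf
      have hc := card_erase_of_mem ha
      refine ih _ ?_ hf (hdisj.mono_right (erase_subset _ _)) ?_
        (fun i hi j hj => hadj i hi j (mem_of_mem_erase hj)) hx hb rfl
      · rw [← hn, hc]
        omega
      · rw [union_comm]
        exact erase_union_eq_sdiff_image_insert hdisj.symm (by rw [union_comm, hunion]) ha
  by_cases hJ2 : 2 ≤ J.card
  · exact hstep hn hdisj hunion hadj hJ2 hxτ hx hy
  by_cases hI2 : 2 ≤ I.card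
  · rw [insert_comm, mul_comm (K.faceWeight (insert x τ))]
    exact hstep (by omega) hdisj.symm (by rw [union_comm, hunion])
      (fun i hi j hj h => hadj j hj i hi (gAdj_comm.1 h)) hI2 hyτ hy hx
  · have hI1 : I = {K.vtype x} := (eq_of_subset_of_card_le (singleton_subset_iff.2 hx)
      (by simp; omega)).symm
    have hJ1 : J = {K.vtype y} := (eq_of_subset_of_card_le (singleton_subset_iff.2 hy)
      (by simp; omega)).symm
    refine faceWeight_mul_of_not_gAdj hconn hτ (i := K.vtype x) (j := K.vtype y) ?_ ?_
      (hadj _ hx _ hy) rfl rfl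
    · intro h
      exact disjoint_left.1 hdisj hx (h ▸ hy)
    · have h1 : ({K.vtype x, K.vtype y} : Finset (Fin (d + 1))) = univ \ τ.image K.vtype := by
        rw [← hunion, hI1, hJ1]
        rfl
      rw [h1]
      simp

/-- Conditioning on a vertex with type in `J` does not change, up to scaling, the edge weights
between vertices with types in `I` when `I` and `J` are separated. -/
theorem linkEdgeWeight_mul_of_separated (hconn : K.TotallyConnected) {τ : Finset V}
    (hτ : K.IsFace τ) {I J : Finset (Fin (d + 1))} (hdisj : Disjoint I J)
    (hunion : I ∪ J = univ \ τ.image K.vtype) (hadj : ∀ i ∈ I, ∀ j ∈ J, ¬ K.gAdj i j) {x y z : V}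
    (hx : K.vtype x ∈ I) (hy : K.vtype y ∈ I) (hz : K.vtype z ∈ J) :
    K.linkEdgeWeight (insert z τ) x y * K.faceWeight τ
      = K.faceWeight (insert z τ) * K.linkEdgeWeight τ x y := by
  by_cases hxy : K.vtype x = K.vtype y
  · rw [linkEdgeWeight_eq_zero_of_vtype_eq _ hxy, linkEdgeWeight_eq_zero_of_vtype_eq _ hxy]
    ring
  have hI : ∀ a, K.vtype a ∈ I → a ∉ τ ∧ a ≠ z := fun a ha =>
    ⟨fun h => (mem_sdiff.1 (hunion ▸ mem_union_left J ha)).2 (mem_image_of_mem _ h),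
      fun h => disjoint_left.1 hdisj ha (h ▸ hz)⟩
  have hne : x ≠ y := fun h => hxy (h ▸ rfl)
  have hx' := hI x hx
  have hy' := hI y hy
  rw [linkEdgeWeight_eq, linkEdgeWeight_eq, if_neg (by simp only [mem_insert]; tauto),
    if_neg (by tauto)]
  by_cases h0 : K.faceWeight (insert x τ) = 0
  · rw [faceWeight_eq_zero_of_subset (insert_subset_insert x (subset_insert y τ)) h0,
      faceWeight_eq_zero_of_subset (insert_subset_insert x
        ((subset_insert z τ).trans (subset_insert y _))) h0]
    ring
  have h1 := faceWeight_mul_of_separated hconn hτ hdisj hunion hadj hx hz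
  have h2 := faceWeight_mul_of_separated hconn (faceWeight_ne_zero_iff.1 h0)
    (hdisj.mono_left (erase_subset _ _)) (erase_union_eq_sdiff_image_insert hdisj hunion hx)
    (fun i hi j hj => hadj i (mem_of_mem_erase hi) j hj)
    (mem_erase.2 ⟨Ne.symm hxy, hy⟩) hz
  rw [insert_comm z x τ, insert_comm y x, insert_comm y x] at h2
  apply mul_right_cancel₀ h0
  linear_combination K.faceWeight τ * h2 + K.faceWeight (insert x (insert y τ)) * h1

theorem linkForm_le_of_separated (hconn : K.TotallyConnected) {τ : Finset V}
    (hτ : K.IsFace τ) {I J : Finset (Fin (d + 1))} (hdisj : Disjoint I J)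
    (hunion : I ∪ J = univ \ τ.image K.vtype) (hadj : ∀ i ∈ I, ∀ j ∈ J, ¬ K.gAdj i j)
    {F : Fin (d + 1) → ℝ} {g : V → ℝ} (hg : ∀ x, K.vtype x ∉ I → g x = 0)
    (h : ∀ σ, K.IsFace σ → σ.image K.vtype = univ \ I →
      K.linkForm σ g ≤ ∑ x, K.linkVertexWeight σ x * F (K.vtype x) * g x ^ 2) :
    K.linkForm τ g ≤ ∑ x, K.linkVertexWeight τ x * F (K.vtype x) * g x ^ 2 := by
  induction J using Finset.induction_on generalizing τ with
  | empty =>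
    refine h τ hτ ?_
    rw [← union_empty I, hunion]
    simp
  | insert j J hj ih =>
    obtain ⟨η, hη, hτη⟩ := id hτ
    obtain ⟨z, hzη, rfl⟩ := exists_vtype_eq hη j
    have hfz : K.IsFace (insert z τ) := ⟨η, hη, insert_subset hzη hτη⟩
    have hzJ : K.vtype z ∈ insert (K.vtype z) J := mem_insert_self _ _
    have hu : I ∪ J = univ \ (insert z τ).image K.vtype := by
      have := erase_union_eq_sdiff_image_insert hdisj.symm (by rw [union_comm, hunion]) hzJ
      rwa [erase_insert hj, union_comm] at this
    have hmain := ih hfz (hdisj.mono_right (subset_insert _ _)) hu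
      (fun i hi j hj => hadj i hi j (mem_insert_of_mem hj))
    have hW := faceWeight_pos_iff.2 hτ
    have hWz := faceWeight_pos_iff.2 hfz
    set ρ := K.faceWeight (insert z τ) / K.faceWeight τ with hρ
    have hρ0 : 0 < ρ := div_pos hWz hW
    have hzW : K.faceWeight (insert z τ) = ρ * K.faceWeight τ := by
      rw [hρ, div_mul_cancel₀ _ hW.ne']
    have hv : ∀ x, K.vtype x ∈ I →
        K.linkVertexWeight (insert z τ) x = ρ * K.linkVertexWeight τ x := by
      intro x hx
      have hxτ : x ∉ τ := fun h =>
        (mem_sdiff.1 (hunion ▸ mem_union_left _ hx)).2 (mem_image_of_mem _ h)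
      have hxz : x ≠ z := fun h => disjoint_left.1 hdisj hx (h ▸ hzJ)
      have h1 := faceWeight_mul_of_separated hconn hτ hdisj hunion hadj hx hzJ
      rw [linkVertexWeight_of_notMem hxτ,
        linkVertexWeight_of_notMem (by simp [hxτ, hxz]), hρ]
      field_simp
      linarith
    have he : ∀ x y, K.vtype x ∈ I → K.vtype y ∈ I →
        K.linkEdgeWeight (insert z τ) x y = ρ * K.linkEdgeWeight τ x y := by
      intro x y hx hy
      have h1 := linkEdgeWeight_mul_of_separated hconn hτ hdisj hunion hadj hx hy hzJ
      rw [hρ]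
      field_simp
      linarith
    have hform : K.linkForm (insert z τ) g = ρ * K.linkForm τ g := by
      have h1 : ∑ x, g x * ∑ y, K.linkEdgeWeight (insert z τ) x y * g y
          = ρ * ∑ x, g x * ∑ y, K.linkEdgeWeight τ x y * g y := by
        simp only [mul_sum]
        refine sum_congr rfl fun x _ => sum_congr rfl fun y _ => ?_
        by_cases hx : K.vtype x ∈ I
        · by_cases hy : K.vtype y ∈ I
          · rw [he x y hx hy]
            ring
          · simp [hg y hy]
        · simp [hg x hx]
      have h2 : ∑ x, K.linkVertexWeight (insert z τ) x * g x
          = ρ * ∑ x, K.linkVertexWeight τ x * g x := by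
        rw [mul_sum]
        refine sum_congr rfl fun x _ => ?_
        by_cases hx : K.vtype x ∈ I
        · rw [hv x hx]
          ring
        · simp [hg x hx]
      unfold linkForm
      rw [h1, h2, hzW]
      field_simp
    have hsum : ∑ x, K.linkVertexWeight (insert z τ) x * F (K.vtype x) * g x ^ 2
        = ρ * ∑ x, K.linkVertexWeight τ x * F (K.vtype x) * g x ^ 2 := by
      rw [mul_sum]
      refine sum_congr rfl fun x _ => ?_
      by_cases hx : K.vtype x ∈ I
      · rw [hv x hx]
        ring
      · simp [hg x hx]
    rw [hform, hsum] at hmain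
    exact le_of_mul_le_mul_left hmain hρ0

theorem mem_gComp {S : Finset (Fin (d + 1))} {i j : Fin (d + 1)} : j ∈ K.gComp S i ↔
    Relation.ReflTransGen (fun a b => a ∉ S ∧ b ∉ S ∧ K.gAdj a b) i j := by
  simp [gComp]

theorem mem_gComp_self (S : Finset (Fin (d + 1))) (i : Fin (d + 1)) : i ∈ K.gComp S i :=
  mem_gComp.2 Relation.ReflTransGen.refl

theorem gComp_subset {S : Finset (Fin (d + 1))} {i : Fin (d + 1)} (hi : i ∉ S) :
    K.gComp S i ⊆ univ \ S := by
  intro j hj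
  rw [mem_gComp] at hj
  rcases Relation.ReflTransGen.cases_tail hj with h | ⟨c, -, h⟩
  · simpa [h] using hi
  · simpa using h.2.1

theorem gComp_eq_of_mem {S : Finset (Fin (d + 1))} {i j : Fin (d + 1)}
    (h : j ∈ K.gComp S i) : K.gComp S j = K.gComp S i := by
  rw [mem_gComp] at h
  have hsymm : Std.Symm fun a b => a ∉ S ∧ b ∉ S ∧ K.gAdj a b :=
    ⟨fun a b h => ⟨h.2.1, h.1, gAdj_comm.1 h.2.2⟩⟩
  ext l
  rw [mem_gComp, mem_gComp]
  exact ⟨fun h' => h.trans h', fun h' => (Relation.ReflTransGen.stdSymm.symm _ _ h).trans h'⟩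

theorem not_gAdj_of_notMem_gComp {S : Finset (Fin (d + 1))} {i a b : Fin (d + 1)} (hi : i ∉ S)
    (ha : a ∈ K.gComp S i) (hb : b ∈ (univ \ S) \ K.gComp S i) : ¬ K.gAdj a b := by
  intro h
  have haS := (mem_sdiff.1 (gComp_subset hi ha)).2
  obtain ⟨hbS, hb⟩ := mem_sdiff.1 hb
  exact hb (mem_gComp.2 ((mem_gComp.1 ha).tail ⟨haS, (mem_sdiff.1 hbS).2, h⟩))

theorem card_gComp_lt {S : Finset (Fin (d + 1))} {i : Fin (d + 1)} (hi : i ∉ S)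
    (hS : ¬ K.GConnOn S) : (K.gComp S i).card < d + 1 - S.card := by
  have hcard : (univ \ S).card = d + 1 - S.card := by
    rw [card_sdiff_of_subset (subset_univ _), card_univ, Fintype.card_fin]
  rw [← hcard]
  refine card_lt_card ((gComp_subset hi).ssubset_of_ne fun h => hS fun a ha b hb => ?_)
  rw [← mem_gComp, gComp_eq_of_mem (i := i) (by simpa [h] using ha), h]
  simpa using hb

/-- Summing over the components of `G_S` picks out the component of a given `i ∉ S`. -/
theorem sum_gComp_ite_mem {S : Finset (Fin (d + 1))} {i : Fin (d + 1)} (hi : i ∉ S)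
    (t : Finset (Fin (d + 1)) → ℝ) :
    ∑ I ∈ (univ \ S).image (fun i => K.gComp S i), (if i ∈ I then t I else 0)
      = t (K.gComp S i) := by
  rw [sum_eq_single (K.gComp S i), if_pos (mem_gComp_self S i)]
  · intro I hI hne
    obtain ⟨j, -, rfl⟩ := mem_image.1 hI
    exact if_neg fun h => hne (gComp_eq_of_mem h).symm
  · intro h
    exact absurd (mem_image_of_mem _ (by simpa using hi)) h

theorem apply_eq_of_not_gConnOn {f : Finset (Fin (d + 1)) → Fin (d + 1) → ℝ}
    (hsupp : ∀ S : Finset (Fin (d + 1)), S.card < d → ∀ i ∈ S, f S i = 0)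
    {S : Finset (Fin (d + 1))} {i : Fin (d + 1)}
    (hdisc : f S i = ∑ I ∈ ((univ \ S).image (fun i => K.gComp S i)).filter
      (fun I => 2 ≤ I.card), f (univ \ I) i) (hi : i ∉ S) :
    f S i = if 2 ≤ (K.gComp S i).card then f (univ \ K.gComp S i) i else 0 := by
  rw [hdisc, sum_filter,
    ← sum_gComp_ite_mem (K := K) hi (fun I => if 2 ≤ I.card then f (univ \ I) i else 0)]
  refine sum_congr rfl fun I _ => ?_
  split_ifs with h1 h2 h2
  · rfl
  · refine hsupp _ ?_ i (by simpa using h2)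
    have := card_le_univ I
    rw [card_sdiff_of_subset (subset_univ _), card_univ, Fintype.card_fin]
    rw [Fintype.card_fin] at this
    omega
  · rfl
  · rfl

theorem apply_le_of_gConnOn {f : Finset (Fin (d + 1)) → Fin (d + 1) → ℝ}
    (hsupp : ∀ S : Finset (Fin (d + 1)), S.card < d → ∀ i ∈ S, f S i = 0)
    (hdisc : ∀ S : Finset (Fin (d + 1)), S.card < d → ¬ K.GConnOn S → ∀ i,
      f S i = ∑ I ∈ ((univ \ S).image (fun i => K.gComp S i)).filter
        (fun I => 2 ≤ I.card), f (univ \ I) i)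
    (hcon : ∀ S : Finset (Fin (d + 1)), S.card < d → K.GConnOn S → ∀ i,
      f S i ≤ (((d + 1 - S.card : ℕ) : ℝ) - 1) ^ 2 / (3 * ((d + 1 - S.card : ℕ) : ℝ) - 1))
    {S : Finset (Fin (d + 1))} (hS : S.card < d) (i : Fin (d + 1)) :
    f S i ≤ (((d + 1 - S.card : ℕ) : ℝ) - 1) ^ 2 / (3 * ((d + 1 - S.card : ℕ) : ℝ) - 1) := by
  induction hn : d + 1 - S.card using Nat.strong_induction_on generalizing S with
  | _ n ih =>
  have hn2 : (2 : ℝ) ≤ n := by exact_mod_cast (by omega : 2 ≤ n)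
  have hpos : 0 ≤ ((n : ℝ) - 1) ^ 2 / (3 * (n : ℝ) - 1) :=
    div_nonneg (sq_nonneg _) (by linarith)
  by_cases hG : K.GConnOn S
  · rw [← hn]
    exact hcon S hS hG i
  by_cases hi : i ∈ S
  · rw [hsupp S hS i hi]
    exact hpos
  rw [apply_eq_of_not_gConnOn hsupp (hdisc S hS hG i) hi]
  split_ifs with h2
  · set I := K.gComp S i
    have hI : I.card < n := hn ▸ card_gComp_lt hi hG
    have hIle : I.card ≤ d + 1 := by omega
    have hc : (univ \ I).card = d + 1 - I.card := by
      rw [card_sdiff_of_subset (subset_univ _), card_univ, Fintype.card_fin]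
    refine (ih I.card hI (S := univ \ I) (by omega) (by omega)).trans ?_
    have h1 : (2 : ℝ) ≤ I.card := by exact_mod_cast h2
    have h3 : (I.card : ℝ) ≤ n := by exact_mod_cast hI.le
    rw [div_le_div_iff₀ (by linarith) (by linarith)]
    obtain ⟨a, ha⟩ : ∃ a : ℝ, (I.card : ℝ) = a + 1 := ⟨_, (sub_add_cancel _ 1).symm⟩
    obtain ⟨b, hb⟩ : ∃ b : ℝ, (n : ℝ) = a + b + 1 := ⟨n - 1 - a, by ring⟩
    rw [ha] at h1 h3 ⊢
    rw [hb] at h3 ⊢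
    have ha0 : 0 ≤ a := by linarith
    have hb0 : 0 ≤ b := by linarith
    have key : (a + b + 1 - 1) ^ 2 * (3 * (a + 1) - 1) - (a + 1 - 1) ^ 2 * (3 * (a + b + 1) - 1)
        = 3 * a ^ 2 * b + 3 * a * b ^ 2 + 4 * a * b + 2 * b ^ 2 := by ring
    have : 0 ≤ 3 * a ^ 2 * b + 3 * a * b ^ 2 + 4 * a * b + 2 * b ^ 2 := by positivity
    linarith
  · exact hpos

/-- If `G_S` splits into components, the form of a link of type `S` splits accordingly. -/
theorem linkForm_eq_sum_gComp (hconn : K.TotallyConnected) {τ : Finset V} (hτ : K.IsFace τ)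
    (g : V → ℝ) : K.linkForm τ g =
      ∑ I ∈ (univ \ τ.image K.vtype).image (fun i => K.gComp (τ.image K.vtype) i),
        K.linkForm τ (fun x => if K.vtype x ∈ I then g x else 0) := by
  set S := τ.image K.vtype with hS
  have hW := faceWeight_pos_iff.2 hτ
  let κ : V → V → ℝ := fun x y => K.linkEdgeWeight τ x y
    - K.linkVertexWeight τ x * K.linkVertexWeight τ y / K.faceWeight τ
  have hform : ∀ h : V → ℝ, K.linkForm τ h = ∑ x, ∑ y, κ x y * (h x * h y) := by
    intro h
    unfold linkForm
    rw [sq, sum_mul_sum, sum_div, ← sum_sub_distrib]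
    refine sum_congr rfl fun x _ => ?_
    rw [mul_sum, sum_div, ← sum_sub_distrib]
    exact sum_congr rfl fun y _ => by ring
  have hκ : ∀ x y, K.vtype x ∉ S → K.vtype y ∉ K.gComp S (K.vtype x) → κ x y = 0 := by
    intro x y hx hy
    by_cases hy0 : K.linkVertexWeight τ y = 0
    · have h1 := linkEdgeWeight_comm (K := K.toWeightedComplex) τ x y
      rw [linkEdgeWeight_eq_zero x hy0] at h1
      simp [κ, h1, hy0]
    obtain ⟨hyτ, hyf⟩ := linkVertexWeight_ne_zero_iff.1 hy0
    have hyS := vtype_notMem_image hyτ hyf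
    have hxτ : x ∉ τ := fun h => hx (mem_image_of_mem _ h)
    have hxy : x ≠ y := fun h => hy (h ▸ mem_gComp_self S _)
    have h1 := faceWeight_mul_of_separated hconn hτ
      (I := K.gComp S (K.vtype x)) (J := (univ \ S) \ K.gComp S (K.vtype x))
      disjoint_sdiff (union_sdiff_of_subset (gComp_subset hx))
      (fun i hi j hj => not_gAdj_of_notMem_gComp hx hi hj) (mem_gComp_self S _)
      (mem_sdiff.2 ⟨mem_sdiff.2 ⟨mem_univ _, hyS⟩, hy⟩)
    simp only [κ]
    rw [linkEdgeWeight_eq, if_neg (by tauto), linkVertexWeight_of_notMem hxτ,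
      linkVertexWeight_of_notMem hyτ, ← h1, mul_div_cancel_right₀ _ hW.ne', sub_self]
  simp only [hform]
  symm
  rw [sum_comm]
  refine sum_congr rfl fun x _ => ?_
  rw [sum_comm]
  refine sum_congr rfl fun y _ => ?_
  by_cases hx : K.vtype x ∈ S
  · have h0 : K.linkVertexWeight τ x = 0 := by
      by_contra h0
      obtain ⟨hxτ, hxf⟩ := linkVertexWeight_ne_zero_iff.1 h0
      exact vtype_notMem_image hxτ hxf hx
    simp [κ, h0, linkEdgeWeight_eq_zero y h0]
  · have h1 : ∀ I : Finset (Fin (d + 1)), κ x y * ((if K.vtype x ∈ I then g x else 0)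
        * (if K.vtype y ∈ I then g y else 0))
        = if K.vtype x ∈ I then (if K.vtype y ∈ I then κ x y * (g x * g y) else 0) else 0 := by
      intro I
      split_ifs <;> simp
    simp only [h1]
    rw [sum_gComp_ite_mem hx (fun I => if K.vtype y ∈ I then κ x y * (g x * g y) else 0)]
    split_ifs with hy
    · rfl
    · rw [hκ x y hx hy, zero_mul]

theorem linkForm_nonpos_of_card_lt {τ : Finset V} {I : Finset (Fin (d + 1))} (hI : I.card < 2)
    {g : V → ℝ} (hg : ∀ x, K.vtype x ∉ I → g x = 0) : K.linkForm τ g ≤ 0 := by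
  have h1 : ∑ x, g x * ∑ y, K.linkEdgeWeight τ x y * g y = 0 := by
    simp only [mul_sum]
    refine sum_eq_zero fun x _ => sum_eq_zero fun y _ => ?_
    by_cases hx : K.vtype x ∈ I
    · by_cases hy : K.vtype y ∈ I
      · rw [linkEdgeWeight_eq_zero_of_vtype_eq τ (card_le_one.1 (by omega) _ hx _ hy)]
        ring
      · simp [hg y hy]
    · simp [hg x hx]
  unfold linkForm
  rw [h1, zero_sub, neg_nonpos]
  exact div_nonneg (sq_nonneg _) (faceWeight_nonneg _)

/-- A face of co-dimension two satisfies the diagonal bound given by its second eigenvalue. -/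
theorem linkForm_le_of_lambda2_le (hconn : K.TotallyConnected) {τ : Finset V} (hτ : K.IsFace τ)
    (hcard : τ.card + 2 = d + 1) {F : Fin (d + 1) → ℝ} (hF0 : ∀ i, 0 ≤ F i)
    (hF : ∀ i ∉ τ.image K.vtype, lambda2 (K.walkMatrix τ) ≤ F i) (g : V → ℝ) :
    K.linkForm τ g ≤ ∑ x, K.linkVertexWeight τ x * F (K.vtype x) * g x ^ 2 := by
  have hr : (d : ℝ) - τ.card = 1 := by
    have : (τ.card : ℝ) + 2 = d + 1 := by exact_mod_cast hcard
    linarith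
  refine (linkForm_le_of_eigenvalue_le hconn hτ hcard.le
    (le_max_right (lambda2 (K.walkMatrix τ)) 0) (fun μ h hμ0 hμr hne hsupp _ heq => ?_) g).trans ?_
  · have := eigenvalue_le_lambda2 hτ hμr hμ0 hne hsupp heq
    rw [hr, one_mul] at this
    exact this.trans (le_max_left _ _)
  · rw [mul_sum]
    refine sum_le_sum fun x _ => ?_
    by_cases hx : K.linkVertexWeight τ x = 0
    · simp [hx]
    obtain ⟨hxτ, hxf⟩ := linkVertexWeight_ne_zero_iff.1 hx
    have h1 := max_le (hF _ (vtype_notMem_image hxτ hxf)) (hF0 (K.vtype x))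
    have h2 : 0 ≤ K.linkVertexWeight τ x * g x ^ 2 :=
      mul_nonneg (linkVertexWeight_nonneg _ _) (sq_nonneg _)
    nlinarith [mul_le_mul_of_nonneg_left h1 h2]

/-- If the diagonal bound holds for the faces complementary to each component of `G_S`, it holds
for every face `τ` of type `S`. -/
theorem linkForm_le_of_gComp (hconn : K.TotallyConnected) {τ : Finset V} (hτ : K.IsFace τ)
    {F : Fin (d + 1) → ℝ} (hF0 : ∀ i, 0 ≤ F i)
    (h : ∀ i ∉ τ.image K.vtype, 2 ≤ (K.gComp (τ.image K.vtype) i).card →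
      ∀ σ, K.IsFace σ → σ.image K.vtype = univ \ K.gComp (τ.image K.vtype) i →
      ∀ g : V → ℝ, (∀ x, K.vtype x ∉ K.gComp (τ.image K.vtype) i → g x = 0) →
      K.linkForm σ g ≤ ∑ x, K.linkVertexWeight σ x * F (K.vtype x) * g x ^ 2)
    (g : V → ℝ) :
    K.linkForm τ g ≤ ∑ x, K.linkVertexWeight τ x * F (K.vtype x) * g x ^ 2 := by
  set S := τ.image K.vtype with hS
  have hsum : ∑ x, K.linkVertexWeight τ x * F (K.vtype x) * g x ^ 2
      = ∑ I ∈ (univ \ S).image (fun i => K.gComp S i), ∑ x, K.linkVertexWeight τ x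
        * F (K.vtype x) * (if K.vtype x ∈ I then g x else 0) ^ 2 := by
    rw [sum_comm]
    refine sum_congr rfl fun x _ => ?_
    by_cases hx : K.linkVertexWeight τ x = 0
    · simp [hx]
    obtain ⟨hxτ, hxf⟩ := linkVertexWeight_ne_zero_iff.1 hx
    rw [← mul_sum, ← sum_gComp_ite_mem (K := K) (vtype_notMem_image hxτ hxf)
      (fun _ => g x ^ 2)]
    congr 1
    refine sum_congr rfl fun I _ => ?_
    split_ifs <;> simp
  rw [linkForm_eq_sum_gComp hconn hτ, hsum]
  refine sum_le_sum fun I hI => ?_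
  obtain ⟨i, hi, rfl⟩ := mem_image.1 hI
  have hiS : i ∉ S := (mem_sdiff.1 hi).2
  have hg : ∀ x, K.vtype x ∉ K.gComp S i →
      (if K.vtype x ∈ K.gComp S i then g x else 0) = 0 := fun x hx => if_neg hx
  by_cases h2 : 2 ≤ (K.gComp S i).card
  · exact linkForm_le_of_separated hconn hτ disjoint_sdiff
      (union_sdiff_of_subset (gComp_subset hiS))
      (fun a ha b hb => not_gAdj_of_notMem_gComp hiS ha hb) hg
      (fun σ hσ hσi => h i hiS h2 σ hσ hσi _ hg)
  · exact (linkForm_nonpos_of_card_lt (not_le.1 h2) hg).trans (sum_nonneg fun x _ =>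
      mul_nonneg (mul_nonneg (linkVertexWeight_nonneg _ _) (hF0 _)) (sq_nonneg _))

end PartiteWeightedComplex

open WeightedComplex PartiteWeightedComplex in
/-- Reduction of the matrix trickle down conditions to scalar inequalities: given a family of
nonnegative vectors `f_S` (for `S ⊂ [d]`, `|S| < d`, each supported on `[d] ∖ S`) satisfying
the component decomposition condition when `G_S` is disconnected and, when `G_S` is connected,
the bound `max_i f_S(i) ≤ (k-1)²/(3k-1)` together with the base (`k = 2`) and recursive
(`k ≥ 3`) inequalities, every face `τ` of co-dimension `k` and type `S` satisfies
`λ₂(P_τ) ≤ max_i f_S(i) / (k-1)`. -/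
theorem scalar_trickle_down_conditions
    {V : Type*} [Fintype V] [DecidableEq V] {d : ℕ}
    (K : PartiteWeightedComplex V d)
    (hconn : K.toWeightedComplex.TotallyConnected)
    (f : Finset (Fin (d + 1)) → Fin (d + 1) → ℝ)
    (hnn : ∀ S i, 0 ≤ f S i)
    (hsupp : ∀ S : Finset (Fin (d + 1)), S.card < d → ∀ i ∈ S, f S i = 0)
    (hdisc : ∀ S : Finset (Fin (d + 1)), S.card < d → ¬ K.GConnOn S →
      ∀ x : Fin (d + 1),
        f S x = ∑ I ∈ ((Finset.univ \ S).image (fun i => K.gComp S i)).filter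
            (fun I => 2 ≤ I.card), f (Finset.univ \ I) x)
    (hcon : ∀ S : Finset (Fin (d + 1)), S.card < d → K.GConnOn S →
      (∀ i : Fin (d + 1),
        f S i ≤ (((d + 1 - S.card : ℕ) : ℝ) - 1) ^ 2 / (3 * ((d + 1 - S.card : ℕ) : ℝ) - 1)) ∧
      (S.card = d - 1 →
        ∀ τ : Finset V, K.toWeightedComplex.IsFace τ → τ.image K.vtype = S →
          ∀ i ∉ S, lambda2 (K.toWeightedComplex.walkMatrix τ) ≤ f S i) ∧
      (S.card + 2 ≤ d → ∀ i ∉ S,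
        ∑ j ∈ Finset.univ \ insert i S, f (insert j S) i ≤
          (((d + 1 - S.card : ℕ) : ℝ) - 2) * f S i - f S i ^ 2)) :
    ∀ k : ℕ, 2 ≤ k → k ≤ d + 1 →
      ∀ τ : Finset V, K.toWeightedComplex.IsFace τ → τ.card = d + 1 - k →
        lambda2 (K.toWeightedComplex.walkMatrix τ) ≤
          (Finset.univ.sup' Finset.univ_nonempty (f (τ.image K.vtype))) / ((k : ℝ) - 1) := by
  have hbound := fun {S} => apply_le_of_gConnOn hsupp hdisc
    (fun S hS hG => (hcon S hS hG).1) (S := S)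
  have hform : ∀ τ : Finset V, K.IsFace τ → τ.card < d → ∀ g : V → ℝ, K.linkForm τ g ≤
      ∑ x, K.linkVertexWeight τ x * f (τ.image K.vtype) (K.vtype x) * g x ^ 2 := by
    intro τ hτ hcard
    induction hn : d - τ.card using Nat.strong_induction_on generalizing τ with
    | _ n ih =>
    have hS := card_image_vtype hτ
    have hSd : (τ.image K.vtype).card < d := by omega
    by_cases hG : K.GConnOn (τ.image K.vtype)
    · obtain ⟨-, hbase, hstep⟩ := hcon _ hSd hG
      by_cases h2 : τ.card + 2 ≤ d
      · have hk : ((d + 1 - (τ.image K.vtype).card : ℕ) : ℝ) = (d : ℝ) + 1 - τ.card := by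
          rw [hS, Nat.cast_sub (by omega)]
          push_cast
          ring
        refine linkForm_le_of_insert hconn hτ h2
          (φ := fun j i => f (insert j (τ.image K.vtype)) i) ?_ ?_ ?_
        · intro j hj i
          have hc : (insert j (τ.image K.vtype)).card = τ.card + 1 := by
            rw [Finset.card_insert_of_notMem hj, hS]
          have h3 := hbound (S := insert j (τ.image K.vtype)) (by omega) i
          have h4 : d + 1 - (insert j (τ.image K.vtype)).card = d - τ.card := by omega
          rwa [h4, Nat.cast_sub hcard.le] at h3
        · intro i hi
          refine (hstep (by omega) i hi).trans (le_of_eq ?_)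
          rw [hk]
          ring
        · intro x hx hf g
          have hc := Finset.card_insert_of_notMem hx
          have h3 := ih _ (by omega) (insert x τ) hf (by omega) rfl g
          rwa [Finset.image_insert] at h3
      · exact linkForm_le_of_lambda2_le hconn hτ (by omega) (hnn _)
          (hbase (by omega) τ hτ rfl)
    · refine linkForm_le_of_gComp hconn hτ (hnn _) ?_
      intro i hi h2 σ hσ hσi g hg
      have hlt := card_gComp_lt hi hG
      have hc := card_image_vtype hσ
      rw [hσi, Finset.card_sdiff_of_subset (Finset.subset_univ _), Finset.card_univ,
        Fintype.card_fin] at hc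
      refine (ih _ (by omega) σ hσ (by omega) rfl g).trans (Finset.sum_le_sum fun x _ => ?_)
      by_cases hx : K.vtype x ∈ K.gComp (τ.image K.vtype) i
      · have hxS := (Finset.mem_sdiff.1 (gComp_subset hi hx)).2
        rw [apply_eq_of_not_gConnOn hsupp (hdisc _ hSd hG _) hxS, gComp_eq_of_mem hx,
          if_pos h2, hσi]
      · simp [hg x hx]
  intro k hk2 hkd τ hτ hcard
  have hle : ∀ i, f (τ.image K.vtype) i ≤
      Finset.univ.sup' Finset.univ_nonempty (f (τ.image K.vtype)) :=
    fun i => Finset.le_sup' _ (Finset.mem_univ i)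
  have hk : (k : ℝ) - 1 = (d : ℝ) - τ.card := by
    rw [hcard, Nat.cast_sub hkd]
    push_cast
    ring
  rw [hk]
  refine lambda2_le hτ (by omega) ((hnn _ 0).trans (hle 0)) fun g => ?_
  refine (hform τ hτ (by omega) g).trans ?_
  rw [Finset.mul_sum]
  refine Finset.sum_le_sum fun x _ => ?_
  have h2 : 0 ≤ K.linkVertexWeight τ x * g x ^ 2 :=
    mul_nonneg (linkVertexWeight_nonneg _ _) (sq_nonneg _)
  nlinarith [mul_le_mul_of_nonneg_left (hle (K.vtype x)) h2]
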